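/- arXiv:math/0504473 — 2 statements merged into one kernel-verified Lean document; each statement's English description precedes it below -/
import Mathlib

section
/- Let n ≥ 1, let U ⊆ ℝⁿ be an open set, and let ψ : U → ℝⁿ be a locally Lipschitz map. Suppose there exists a constant c > 0 such that for almost every x ∈ U, ψ is differentiable at x and det Dψ(x) > c. Then ψ is an open map: the image under ψ of every open subset of U is open in ℝⁿ. -/
open MeasureTheory

/-- The determinant of `M` is a fixed linear combination of the values `det (1 + t • M)`, for
finitely many arbitrarily small `t > 0`, and the weights add up to zero. -/
theorem exists_det_eq_sum_det_one_add_smul {E : Type*} [NormedAddCommGroup E] [NormedSpace ℝ E]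
    [FiniteDimensional ℝ E] [Nontrivial E] {ε : ℝ} (hε : 0 < ε) :
    ∃ (s : Finset ℝ) (w : ℝ → ℝ), (∀ t ∈ s, t ∈ Set.Ioo 0 ε) ∧ ∑ t ∈ s, w t = 0 ∧
      ∀ M : E →L[ℝ] E, M.det = ∑ t ∈ s, w t * (1 + t • M).det := by
  classical
  obtain ⟨s, hs, hcard⟩ :=
    (Set.Ioo_infinite hε).exists_subset_card_eq (Module.finrank ℝ E + 1)
  set w : ℝ → ℝ := fun t ↦ (∏ j ∈ s.erase t, (t - j))⁻¹ with hw
  have key : ∀ M : E →L[ℝ] E, M.det = ∑ t ∈ s, w t * (1 + t • M).det := by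
    intro M
    let b := Module.finBasis ℝ E
    let A := LinearMap.toMatrix b b (M : E →ₗ[ℝ] E)
    let P : Polynomial ℝ := Matrix.det
      ((Polynomial.X : Polynomial ℝ) • A.map Polynomial.C + (1 : Matrix _ _ ℝ).map Polynomial.C)
    have hdeg : P.degree < s.card := by
      refine Polynomial.degree_le_natDegree.trans_lt ?_
      rw [hcard]
      have := Polynomial.natDegree_det_X_add_C_le A 1
      rw [Fintype.card_fin] at this
      exact_mod_cast Nat.lt_succ_of_le this
    have h1 := Lagrange.coeff_eq_sum (v := id) (Set.injOn_id _) hdeg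
    have h2 := Polynomial.coeff_det_X_add_C_card A 1
    rw [Fintype.card_fin] at h2
    rw [hcard, Nat.add_sub_cancel, h2] at h1
    have hM : M.det = A.det := (LinearMap.det_toMatrix b _).symm
    rw [hM, h1]
    refine Finset.sum_congr rfl fun t _ ↦ ?_
    have h3 : P.eval t = (1 + t • M).det := by
      have : (1 + t • M).det = (1 + t • A).det := by
        rw [ContinuousLinearMap.det, ← LinearMap.det_toMatrix b]
        congr 1
        simp [A, LinearMap.toMatrix_one]
      rw [this]
      simp only [P]
      rw [← Polynomial.coe_evalRingHom, RingHom.map_det]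
      congr 1
      ext i j
      simp [Matrix.one_apply, apply_ite, add_comm]
      rw [mul_comm]
    simp only [id, h3, hw, div_eq_inv_mul]
  refine ⟨s, w, fun t ht ↦ hs ht, ?_, key⟩
  have := key 0
  have h0 : (0 : E →L[ℝ] E).det = 0 := by
    simp [ContinuousLinearMap.det]
  have h1 : (1 : E →L[ℝ] E).det = 1 := by simp [ContinuousLinearMap.det]
  simpa [h0, h1] using this.symm

theorem LipschitzWith.addHaar_image_eq_zero {E : Type*} [NormedAddCommGroup E]
    [NormedSpace ℝ E] [FiniteDimensional ℝ E] [MeasurableSpace E] [BorelSpace E] (μ : Measure E)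
    [μ.IsAddHaarMeasure] {K : NNReal} {f : E → E} (hf : LipschitzWith K f) {s : Set E}
    (hs : μ s = 0) : μ (f '' s) = 0 := by
  have h1 : Measure.hausdorffMeasure (Module.finrank ℝ E) ≪ μ :=
    Measure.absolutelyContinuous_isAddHaarMeasure _ _
  have h2 : μ ≪ Measure.hausdorffMeasure (Module.finrank ℝ E) :=
    Measure.absolutelyContinuous_isAddHaarMeasure _ _
  apply h2
  have := hf.hausdorffMeasure_image_le (d := Module.finrank ℝ E) (by positivity) s
  rwa [h1 hs, mul_zero, nonpos_iff_eq_zero] at this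

/-- If a Lipschitz map `F` vanishes off `B`, then for small `t > 0` the map `id + t • F` permutes
`B`, so that its Jacobian determinant integrates to the measure of `B`. -/
theorem LipschitzWith.exists_setIntegral_det_one_add_smul_fderiv {E : Type*}
    [NormedAddCommGroup E] [NormedSpace ℝ E] [FiniteDimensional ℝ E] [Nontrivial E]
    [MeasurableSpace E] [BorelSpace E] (μ : Measure E) [μ.IsAddHaarMeasure] {K : NNReal}
    {F : E → E} (hF : LipschitzWith K F) {B : Set E} (hB : MeasurableSet B)
    (hFB : ∀ x ∉ B, F x = 0) :
    ∃ ε : ℝ, 0 < ε ∧ ∀ t ∈ Set.Ioo 0 ε, ∫ x in B, (1 + t • fderiv ℝ F x).det ∂μ = μ.real B := by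
  have hdet : ∀ᶠ M in nhds (0 : E →L[ℝ] E), 0 < (1 + M).det := by
    have hc : Continuous fun M : E →L[ℝ] E ↦ (1 + M).det :=
      ContinuousLinearMap.continuous_det.comp (continuous_const.add continuous_id)
    refine hc.continuousAt.eventually (lt_mem_nhds ?_)
    simp [ContinuousLinearMap.det]
  obtain ⟨ρ, hρ, hdet⟩ := Metric.eventually_nhds_iff.1 hdet
  refine ⟨min 1 ρ / (K + 1), by positivity, fun t ⟨ht0, ht⟩ ↦ ?_⟩
  rw [lt_div_iff₀ (by positivity), lt_min_iff] at ht
  have hK0 : (0 : ℝ) ≤ K := K.2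
  let T : NNReal := ⟨t, ht0.le⟩
  let f : E → E := fun x ↦ x + t • F x
  have htF : LipschitzWith (T * K) fun x ↦ t • F x := by
    refine LipschitzWith.of_dist_le_mul fun x y ↦ ?_
    rw [dist_smul₀, Real.norm_of_nonneg ht0.le, NNReal.coe_mul, mul_assoc]
    exact mul_le_mul_of_nonneg_left (hF.dist_le_mul x y) ht0.le
  have happ : ApproximatesLinearOn f ((ContinuousLinearEquiv.refl ℝ E : E ≃L[ℝ] E) : E →L[ℝ] E)
      Set.univ (T * K) := by
    rw [ApproximatesLinearOn.approximatesLinearOn_iff_lipschitzOnWith, lipschitzOnWith_univ]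
    convert htF using 1
    ext x
    simp [f]
  have hlt : T * K < ‖((ContinuousLinearEquiv.refl ℝ E).symm : E →L[ℝ] E)‖₊⁻¹ := by
    have : ‖((ContinuousLinearEquiv.refl ℝ E).symm : E →L[ℝ] E)‖₊ = 1 := by
      ext; exact ContinuousLinearMap.norm_id
    rw [this, inv_one, ← NNReal.coe_lt_coe, NNReal.coe_mul, NNReal.coe_one]
    change t * K < 1
    nlinarith
  have hinj : Function.Injective f := Set.injOn_univ.1 (happ.injOn (Or.inr hlt))
  have hsurj : Function.Surjective f := happ.surjective (Or.inr hlt)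
  have hoff : ∀ x ∉ B, f x = x := fun x hx ↦ by simp [f, hFB x hx]
  have himage : f '' B = B := by
    ext y
    constructor
    · rintro ⟨x, hx, rfl⟩
      by_contra h
      exact h ((hinj (hoff _ h)).symm ▸ hx)
    · intro hy
      obtain ⟨x, rfl⟩ := hsurj y
      by_cases hx : x ∈ B
      · exact ⟨x, hx, rfl⟩
      · exact absurd (hoff x hx ▸ hy) hx
  let D : Set E := {x | DifferentiableAt ℝ F x}
  have hD : MeasurableSet D := measurableSet_of_differentiableAt ℝ F
  have hDnull : μ Dᶜ = 0 := hF.ae_differentiableAt (μ := μ)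
  have hflip : LipschitzWith (1 + T * K) f := LipschitzWith.id.add htF
  have hae : (B ∩ D : Set E) =ᵐ[μ] B :=
    inter_ae_eq_left_of_ae_eq_univ (Filter.eventuallyEq_univ.2 (mem_ae_iff.2 hDnull))
  have hae' : (f '' (B ∩ D) : Set E) =ᵐ[μ] B := by
    refine Filter.EventuallyLE.antisymm ?_ ?_
    · exact (Set.image_mono Set.inter_subset_left |>.trans himage.subset).eventuallyLE
    · rw [ae_le_set]
      refine measure_mono_null ?_ (hflip.addHaar_image_eq_zero μ hDnull)
      rintro _ ⟨hy, h⟩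
      rw [← himage] at hy
      obtain ⟨x, hx, rfl⟩ := hy
      exact ⟨x, fun hxD ↦ h ⟨x, ⟨hx, hxD⟩, rfl⟩, rfl⟩
  have hcov := integral_image_eq_integral_abs_det_fderiv_smul μ (hB.inter hD)
    (f := f) (f' := fun x ↦ 1 + t • fderiv ℝ F x)
    (fun x hx ↦ ((hasFDerivAt_id x).add (hx.2.hasFDerivAt.const_smul t)).hasFDerivWithinAt)
    hinj.injOn (fun _ ↦ (1 : ℝ))
  rw [setIntegral_congr_set hae', setIntegral_congr_set hae] at hcov
  simp only [integral_const, smul_eq_mul, mul_one, measureReal_restrict_apply_univ] at hcov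
  rw [hcov]
  refine integral_congr_ae (Filter.Eventually.of_forall fun x ↦ ?_)
  refine (abs_of_pos (hdet ?_)).symm
  rw [dist_zero_right, norm_smul, Real.norm_of_nonneg ht0.le]
  have := norm_fderiv_le_of_lipschitz ℝ hF (x₀ := x)
  nlinarith

/-- The Jacobian determinant is a null Lagrangian: it integrates to zero over `B` for a Lipschitz
map vanishing off `B`. -/
theorem LipschitzWith.setIntegral_det_fderiv_eq_zero {E : Type*}
    [NormedAddCommGroup E] [NormedSpace ℝ E] [FiniteDimensional ℝ E] [Nontrivial E]
    [MeasurableSpace E] [BorelSpace E] (μ : Measure E) [μ.IsAddHaarMeasure] {K : NNReal}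
    {F : E → E} (hF : LipschitzWith K F) {B : Set E} (hB : MeasurableSet B) (hμB : μ B ≠ ⊤)
    (hFB : ∀ x ∉ B, F x = 0) :
    IntegrableOn (fun x ↦ (fderiv ℝ F x).det) B μ ∧ ∫ x in B, (fderiv ℝ F x).det ∂μ = 0 := by
  have hint : ∀ L : (E →L[ℝ] E) → (E →L[ℝ] E), Continuous L →
      IntegrableOn (fun x ↦ (L (fderiv ℝ F x)).det) B μ := by
    intro L hL
    have hc := ContinuousLinearMap.continuous_det.comp hL
    obtain ⟨C, hC⟩ := (isCompact_closedBall (0 : E →L[ℝ] E) K).exists_bound_of_continuousOn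
      hc.continuousOn
    refine Measure.integrableOn_of_bounded (M := C) hμB
      (hc.measurable.comp (measurable_fderiv ℝ F)).aestronglyMeasurable ?_
    exact Filter.Eventually.of_forall fun x ↦ hC _
      (by simpa using norm_fderiv_le_of_lipschitz ℝ hF)
  refine ⟨hint id continuous_id, ?_⟩
  obtain ⟨ε, hε, h⟩ := hF.exists_setIntegral_det_one_add_smul_fderiv μ hB hFB
  obtain ⟨s, w, hs, hw, hdet⟩ := exists_det_eq_sum_det_one_add_smul (E := E) hε
  rw [funext fun x ↦ hdet (fderiv ℝ F x), integral_finsetSum]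
  · simp_rw [integral_const_mul]
    rw [Finset.sum_congr rfl fun t ht ↦ by rw [h t (hs t ht)], ← Finset.sum_mul, hw, zero_mul]
  · exact fun t _ ↦ (hint (fun M ↦ 1 + t • M) (by fun_prop)).const_mul _

theorem ContinuousLinearMap.exists_det_add_smul_le {E : Type*} [NormedAddCommGroup E]
    [NormedSpace ℝ E] [FiniteDimensional ℝ E] (a b : ℝ) {c : ℝ} (hc : 0 < c) :
    ∃ C : ℝ, 0 < C ∧ ∀ A M : E →L[ℝ] E, ‖A‖ ≤ a → ‖M‖ ≤ b → A.det ≤ -c → ∀ s : ℝ, 0 < s →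
      (A + s • M).det ≤ C * s ^ (2 * Module.finrank ℝ E) - c / 2 := by
  set n := Module.finrank ℝ E
  have hdet : Continuous fun M : E →L[ℝ] E ↦ M.det := ContinuousLinearMap.continuous_det
  obtain ⟨δ, hδ, hunif⟩ := Metric.uniformContinuousOn_iff.1
    ((isCompact_closedBall (0 : E →L[ℝ] E) (|a| + |b|)).uniformContinuousOn_of_continuous
      hdet.continuousOn) (c / 2) (by positivity)
  set θ := min 1 (δ / (|b| + 1)) with hθ
  have hθ0 : 0 < θ := by positivity
  obtain ⟨C₁, hC₁⟩ := (isCompact_closedBall (0 : E →L[ℝ] E)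
    (θ⁻¹ * |a| + |b|)).exists_bound_of_continuousOn hdet.continuousOn
  have hC₁0 : 0 ≤ C₁ := (norm_nonneg _).trans (hC₁ 0 (by simp; positivity))
  refine ⟨C₁ / θ ^ n + c / 2 / θ ^ (2 * n), by positivity, fun A M hA hM hAc s hs ↦ ?_⟩
  replace hA := hA.trans (le_abs_self a)
  replace hM := hM.trans (le_abs_self b)
  rcases lt_or_ge s θ with hsθ | hsθ
  · have hs1 : s < 1 := hsθ.trans_le (min_le_left _ _)
    have hs2 : s * (|b| + 1) < δ := (lt_div_iff₀ (by positivity)).1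
      (hsθ.trans_le (min_le_right _ _))
    have hsM : ‖s • M‖ ≤ s * |b| := by
      rw [norm_smul, Real.norm_of_nonneg hs.le]
      gcongr
    have h := hunif (A + s • M) (by
        rw [mem_closedBall_zero_iff]
        refine (norm_add_le _ _).trans (add_le_add hA (hsM.trans ?_))
        nlinarith [abs_nonneg b]) A (by
        rw [mem_closedBall_zero_iff]
        linarith [abs_nonneg b]) (by
        rw [dist_eq_norm, add_sub_cancel_left]
        nlinarith)
    rw [Real.dist_eq] at h
    have h1 := (abs_lt.1 h).2
    have h2 : 0 ≤ (C₁ / θ ^ n + c / 2 / θ ^ (2 * n)) * s ^ (2 * n) := by positivity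
    linarith
  · have h1 : A + s • M = s • (s⁻¹ • A + M) := by
      rw [smul_add, smul_smul, mul_inv_cancel₀ hs.ne', one_smul]
    have h2 : (s⁻¹ • A + M).det ≤ C₁ := by
      refine (le_abs_self _).trans (hC₁ _ ?_)
      rw [mem_closedBall_zero_iff]
      refine (norm_add_le _ _).trans (add_le_add ?_ hM)
      rw [norm_smul, Real.norm_of_nonneg (by positivity)]
      gcongr
    have h3 : (s • (s⁻¹ • A + M)).det = s ^ n * (s⁻¹ • A + M).det := by
      simp only [ContinuousLinearMap.det, ContinuousLinearMap.toLinearMap_smul, LinearMap.det_smul]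
      rfl
    have h4 : 1 ≤ s ^ n / θ ^ n := by
      rw [← div_pow]
      exact one_le_pow₀ ((one_le_div hθ0).2 hsθ)
    have h5 : 1 ≤ s ^ (2 * n) / θ ^ (2 * n) := by
      rw [← div_pow]
      exact one_le_pow₀ ((one_le_div hθ0).2 hsθ)
    have h6 : C₁ / θ ^ n * s ^ (2 * n) = s ^ n * C₁ * (s ^ n / θ ^ n) := by
      rw [two_mul, pow_add]
      ring
    have h7 : c / 2 / θ ^ (2 * n) * s ^ (2 * n) = c / 2 * (s ^ (2 * n) / θ ^ (2 * n)) := by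
      ring
    rw [h1, h3, add_mul, h6, h7]
    have h8 : s ^ n * (s⁻¹ • A + M).det ≤ s ^ n * C₁ := by gcongr
    have h9 : s ^ n * C₁ ≤ s ^ n * C₁ * (s ^ n / θ ^ n) :=
      le_mul_of_one_le_right (by positivity) h4
    have h10 : c / 2 ≤ c / 2 * (s ^ (2 * n) / θ ^ (2 * n)) :=
      le_mul_of_one_le_right (by positivity) h5
    linarith

theorem LipschitzWith.smul_of_lipschitzOnWith {X E : Type*} [PseudoMetricSpace X]
    [NormedAddCommGroup E] [NormedSpace ℝ E] {ζ : X → ℝ} {Y : X → E} {K L M Z : NNReal}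
    {B : Set X} (hζ : LipschitzWith K ζ) (hY : LipschitzOnWith L Y B)
    (hM : ∀ x ∈ B, ‖Y x‖ ≤ M) (hZ : ∀ x, |ζ x| ≤ Z) (h0 : ∀ x ∉ B, ζ x = 0) :
    LipschitzWith (K * M + Z * L) fun x ↦ ζ x • Y x := by
  have key : ∀ x ∈ B, ∀ y, dist (ζ x • Y x) (ζ y • Y y) ≤ (K * M + Z * L : NNReal) * dist x y := by
    intro x hx y
    have h1 : |ζ x - ζ y| ≤ K * dist x y := by
      rw [← Real.dist_eq]
      exact hζ.dist_le_mul x y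
    have h2 : |ζ x - ζ y| * ‖Y x‖ ≤ K * dist x y * M :=
      mul_le_mul h1 (hM x hx) (norm_nonneg _) (by positivity)
    have h3 : |ζ y| * ‖Y x - Y y‖ ≤ Z * (L * dist x y) := by
      by_cases hy : y ∈ B
      · refine mul_le_mul (hZ y) ?_ (norm_nonneg _) Z.2
        rw [← dist_eq_norm]
        exact hY.dist_le_mul x hx y hy
      · rw [h0 y hy, abs_zero, zero_mul]
        positivity
    have h4 : ζ x • Y x - ζ y • Y y = (ζ x - ζ y) • Y x + ζ y • (Y x - Y y) := by
      rw [sub_smul, smul_sub]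
      abel
    rw [dist_eq_norm, h4]
    refine (norm_add_le _ _).trans ?_
    rw [norm_smul, norm_smul, Real.norm_eq_abs, Real.norm_eq_abs]
    push_cast
    linarith
  refine LipschitzWith.of_dist_le_mul fun x y ↦ ?_
  by_cases hx : x ∈ B
  · exact key x hx y
  by_cases hy : y ∈ B
  · rw [dist_comm, dist_comm x y]
    exact key y hy x
  · rw [h0 x hx, h0 y hy, zero_smul, zero_smul, dist_self]
    positivity

theorem lipschitzWith_sq_sq_sub_min_dist_sq {X : Type*} [PseudoMetricSpace X] (x₀ : X) {r : ℝ}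
    (hr : 0 ≤ r) :
    LipschitzWith (Real.toNNReal (4 * r ^ 3)) fun x ↦ (r ^ 2 - min (dist x x₀) r ^ 2) ^ 2 := by
  refine LipschitzWith.of_dist_le' fun x y ↦ ?_
  have hd : |min (dist x x₀) r - min (dist y x₀) r| ≤ dist x y := by
    have := ((LipschitzWith.dist_left x₀).min_const r).dist_le_mul x y
    rwa [NNReal.coe_one, one_mul, Real.dist_eq] at this
  have hx0 : 0 ≤ min (dist x x₀) r := le_min dist_nonneg hr
  have hy0 : 0 ≤ min (dist y x₀) r := le_min dist_nonneg hr
  have hxr : min (dist x x₀) r ≤ r := min_le_right _ _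
  have hyr : min (dist y x₀) r ≤ r := min_le_right _ _
  generalize min (dist x x₀) r = a at *
  generalize min (dist y x₀) r = b at *
  have h1 : (r ^ 2 - a ^ 2) ^ 2 - (r ^ 2 - b ^ 2) ^ 2 =
      (-(r ^ 2 - a ^ 2 + (r ^ 2 - b ^ 2)) * (a + b)) * (a - b) := by ring
  have ha : a ^ 2 ≤ r ^ 2 := by gcongr
  have hb : b ^ 2 ≤ r ^ 2 := by gcongr
  rw [Real.dist_eq, h1, abs_mul]
  refine mul_le_mul ?_ hd (abs_nonneg _) (by positivity)
  rw [abs_mul, abs_neg, abs_of_nonneg (by linarith), abs_of_nonneg (a := a + b) (by linarith)]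
  calc _ ≤ (2 * r ^ 2) * (2 * r) := by
        gcongr <;> nlinarith
    _ = _ := by ring

theorem det_reflection_orthogonal_span_singleton {E : Type*} [NormedAddCommGroup E]
    [InnerProductSpace ℝ E] [FiniteDimensional ℝ E] {v : E} (hv : v ≠ 0) :
    ((ℝ ∙ v)ᗮ.reflection : E →L[ℝ] E).det = -1 := by
  have := (ℝ ∙ v)ᗮ.det_reflection
  rw [Submodule.orthogonal_orthogonal, finrank_span_singleton hv, pow_one] at this
  exact this

/-- A uniform integral bound for points `y` omitted by `ψ`, obtained by integrating the Jacobian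
determinant of the inversion of `ψ` centred at `y`, cut off by `(r ^ 2 - dist x x₀ ^ 2) ^ 2`. -/
theorem exists_setIntegral_pow_le_of_notMem_image {E : Type*} [NormedAddCommGroup E]
    [InnerProductSpace ℝ E] [FiniteDimensional ℝ E] [Nontrivial E] [MeasurableSpace E]
    [BorelSpace E] (μ : Measure E) [μ.IsAddHaarMeasure] {ψ : E → E} {x₀ : E} {r : ℝ} (hr : 0 < r)
    {L : NNReal} (hψ : LipschitzOnWith L ψ (Metric.closedBall x₀ r)) {c : ℝ} (hc : 0 < c)
    (hjac : ∀ᵐ x ∂(μ.restrict (Metric.ball x₀ r)),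
      DifferentiableAt ℝ ψ x ∧ c < (fderiv ℝ ψ x).det) :
    ∃ C : ℝ, 0 < C ∧ ∀ y ∉ ψ '' Metric.closedBall x₀ r,
      IntegrableOn (fun x ↦ ((r ^ 2 - dist x x₀ ^ 2) / dist (ψ x) y) ^ (2 * Module.finrank ℝ E))
        (Metric.ball x₀ r) μ ∧
      ∫ x in Metric.ball x₀ r,
        ((r ^ 2 - dist x x₀ ^ 2) / dist (ψ x) y) ^ (2 * Module.finrank ℝ E) ∂μ ≤ C := by
  set n := Module.finrank ℝ E with hn
  obtain ⟨C, hC0, hC⟩ := ContinuousLinearMap.exists_det_add_smul_le (E := E) L (4 * r) hc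
  have hvol : 0 < μ.real (Metric.ball x₀ r) :=
    ENNReal.toReal_pos (Metric.measure_ball_pos μ x₀ hr).ne' measure_ball_lt_top.ne
  refine ⟨C * μ.real (Metric.ball x₀ r) / (c / 2), by positivity, fun y hy ↦ ?_⟩
  have hne : ∀ x ∈ Metric.closedBall x₀ r, ψ x ≠ y := fun x hx h ↦ hy ⟨x, hx, h⟩
  have hdist : ContinuousOn (fun x ↦ dist (ψ x) y) (Metric.closedBall x₀ r) :=
    continuous_dist.comp_continuousOn (hψ.continuousOn.prodMk continuousOn_const)
  have hcont : ContinuousOn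
      (fun x ↦ ((r ^ 2 - dist x x₀ ^ 2) / dist (ψ x) y) ^ (2 * n)) (Metric.closedBall x₀ r) :=
    ((by fun_prop : Continuous fun x ↦ r ^ 2 - dist x x₀ ^ 2).continuousOn.div
      hdist fun x hx ↦ dist_ne_zero.2 (hne x hx)).pow _
  have hint : IntegrableOn (fun x ↦ ((r ^ 2 - dist x x₀ ^ 2) / dist (ψ x) y) ^ (2 * n))
      (Metric.ball x₀ r) μ :=
    (hcont.integrableOn_compact (isCompact_closedBall x₀ r)).mono_set Metric.ball_subset_closedBall
  refine ⟨hint, ?_⟩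
  obtain ⟨m, hm, hmd⟩ : ∃ m : ℝ, 0 < m ∧ ∀ x ∈ Metric.closedBall x₀ r, m ≤ dist (ψ x) y := by
    obtain ⟨z, hz, hmin⟩ := (isCompact_closedBall x₀ r).exists_isMinOn
      ⟨x₀, Metric.mem_closedBall_self hr.le⟩ hdist
    exact ⟨_, dist_pos.2 (hne z hz), hmin⟩
  let Y : E → E := fun x ↦ EuclideanGeometry.inversion y 1 (ψ x) - y
  let ζ : E → ℝ := fun x ↦ (r ^ 2 - min (dist x x₀) r ^ 2) ^ 2
  have hY : LipschitzOnWith (Real.toNNReal ((m * m)⁻¹ * L)) Y (Metric.ball x₀ r) := by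
    refine LipschitzOnWith.of_dist_le' fun x hx z hz ↦ ?_
    replace hx := Metric.ball_subset_closedBall hx
    replace hz := Metric.ball_subset_closedBall hz
    rw [dist_sub_right, EuclideanGeometry.dist_inversion_inversion (hne x hx) (hne z hz), one_pow,
      one_div, mul_assoc]
    gcongr
    · exact hmd x hx
    · exact hmd z hz
    · exact hψ.dist_le_mul x hx z hz
  have hYM : ∀ x ∈ Metric.ball x₀ r, ‖Y x‖ ≤ Real.toNNReal m⁻¹ := by
    intro x hx
    rw [Real.coe_toNNReal _ (by positivity), ← dist_eq_norm,
      EuclideanGeometry.dist_inversion_center, one_pow, one_div]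
    exact inv_anti₀ hm (hmd x (Metric.ball_subset_closedBall hx))
  have hζZ : ∀ x, |ζ x| ≤ Real.toNNReal ((r ^ 2) ^ 2) := by
    intro x
    rw [Real.coe_toNNReal _ (by positivity), abs_of_nonneg (sq_nonneg _)]
    have h1 : min (dist x x₀) r ^ 2 ≤ r ^ 2 :=
      pow_le_pow_left₀ (le_min dist_nonneg hr.le) (min_le_right _ _) 2
    exact pow_le_pow_left₀ (by linarith) (by linarith [sq_nonneg (min (dist x x₀) r)]) 2
  have hζ0 : ∀ x ∉ Metric.ball x₀ r, ζ x = 0 := by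
    intro x hx
    rw [Metric.mem_ball, not_lt] at hx
    simp [ζ, min_eq_right hx]
  have hζ : LipschitzWith _ ζ := lipschitzWith_sq_sq_sub_min_dist_sq x₀ hr.le
  have hF := hζ.smul_of_lipschitzOnWith hY hYM hζZ hζ0
  obtain ⟨hFint, hF0⟩ := hF.setIntegral_det_fderiv_eq_zero μ Metric.isOpen_ball.measurableSet
    measure_ball_lt_top.ne fun x hx ↦ by rw [hζ0 x hx, zero_smul]
  have hle : ∀ᵐ x ∂(μ.restrict (Metric.ball x₀ r)), (fderiv ℝ (fun x ↦ ζ x • Y x) x).det ≤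
      C - c / 2 * ((r ^ 2 - dist x x₀ ^ 2) / dist (ψ x) y) ^ (2 * n) := by
    filter_upwards [hjac, ae_restrict_mem Metric.isOpen_ball.measurableSet] with x ⟨hdx, hcx⟩ hx
    have hyx := hne x (Metric.ball_subset_closedBall hx)
    have hu : 0 < dist (ψ x) y := dist_pos.2 hyx
    set u := dist (ψ x) y with hu_def
    have hη : 0 < r ^ 2 - dist x x₀ ^ 2 :=
      sub_pos.2 (pow_lt_pow_left₀ (Metric.mem_ball.1 hx) dist_nonneg two_ne_zero)
    set η := r ^ 2 - dist x x₀ ^ 2 with hη_def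
    let R : E →L[ℝ] E := ((ℝ ∙ (ψ x - y))ᗮ.reflection : E →L[ℝ] E)
    have hYd : HasFDerivAt Y (((1 / u) ^ 2 • R).comp (fderiv ℝ ψ x)) x :=
      ((EuclideanGeometry.hasFDerivAt_inversion (R := 1) hyx).comp x hdx.hasFDerivAt).sub_const y
    have hζd : HasFDerivAt ζ ((2 * η) • (-(2 • innerSL ℝ (x - x₀)) : E →L[ℝ] ℝ)) x := by
      have h1 : HasFDerivAt (fun z ↦ r ^ 2 - ‖z - x₀‖ ^ 2)
          (-(2 • innerSL ℝ (x - x₀)) : E →L[ℝ] ℝ) x :=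
        (((hasFDerivAt_id x).sub_const x₀).norm_sq).const_sub (r ^ 2)
      have h2 := h1.pow 2
      rw [← dist_eq_norm] at h2
      refine HasFDerivAt.congr_of_eventuallyEq (by simpa using h2) ?_
      filter_upwards [Metric.isOpen_ball.mem_nhds hx] with z hz
      simp only [ζ, ← dist_eq_norm, min_eq_left (Metric.mem_ball.1 hz).le]
    have hFd := hζd.smul hYd
    let A : E →L[ℝ] E := R.comp (fderiv ℝ ψ x)
    let M : E →L[ℝ] E := (2 • (-(2 • innerSL ℝ (x - x₀)) : E →L[ℝ] ℝ)).smulRight (u⁻¹ • (ψ x - y))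
    have hA : ‖A‖ ≤ L := by
      refine ContinuousLinearMap.opNorm_le_bound _ L.2 fun v ↦ ?_
      have : ‖A v‖ = ‖fderiv ℝ ψ x v‖ :=
        (ℝ ∙ (ψ x - y))ᗮ.reflection.norm_map (fderiv ℝ ψ x v)
      rw [this]
      exact ContinuousLinearMap.le_of_opNorm_le _ (norm_fderiv_le_of_lipschitzOn ℝ
        (Metric.closedBall_mem_nhds_of_mem hx) hψ) v
    have hM : ‖M‖ ≤ 4 * r := by
      have h1 : ‖u⁻¹ • (ψ x - y)‖ = 1 := by
        rw [norm_smul, ← dist_eq_norm, Real.norm_of_nonneg (by positivity), inv_mul_cancel₀ hu.ne']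
      rw [ContinuousLinearMap.norm_smulRight_apply, h1, mul_one, ← Nat.cast_smul_eq_nsmul ℝ,
        ← Nat.cast_smul_eq_nsmul ℝ, norm_smul, norm_neg, norm_smul, innerSL_apply_norm,
        ← dist_eq_norm]
      have := (Metric.mem_ball.1 hx).le
      norm_num
      linarith
    have hAc : A.det ≤ -c := by
      have h1 : A.det = R.det * (fderiv ℝ ψ x).det := LinearMap.det_comp _ _
      rw [h1, det_reflection_orthogonal_span_singleton (sub_ne_zero.2 hyx)]
      linarith
    have hsplit : fderiv ℝ (fun x ↦ ζ x • Y x) x = ((η / u) ^ 2) • (A + (u / η) • M) := by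
      rw [show fderiv ℝ (fun x ↦ ζ x • Y x) x = _ from hFd.fderiv]
      have hζx : ζ x = η ^ 2 := by
        simp only [ζ, min_eq_left (Metric.mem_ball.1 hx).le, hη_def]
      have hYx : Y x = (1 / u) ^ 2 • (ψ x - y) := by
        simp [Y, EuclideanGeometry.inversion, hu_def]
      rw [hζx, hYx]
      ext1 v
      simp only [A, M, add_apply, smul_apply,
        ContinuousLinearMap.comp_apply, ContinuousLinearMap.smulRight_apply,
        neg_apply, smul_add, smul_smul, nsmul_eq_mul, smul_eq_mul]
      congr 2
      · field_simp
      · field_simp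
        norm_num
    have hdet : (fderiv ℝ (fun x ↦ ζ x • Y x) x).det =
        (η / u) ^ (2 * n) * (A + (u / η) • M).det := by
      rw [hsplit, pow_mul]
      simp only [ContinuousLinearMap.det, ContinuousLinearMap.toLinearMap_smul, LinearMap.det_smul]
      rfl
    rw [hdet]
    have h1 := hC A M hA hM hAc (u / η) (by positivity)
    calc _ ≤ (η / u) ^ (2 * n) * (C * (u / η) ^ (2 * n) - c / 2) := by gcongr
      _ = C * ((η / u) * (u / η)) ^ (2 * n) - c / 2 * (η / u) ^ (2 * n) := by
        rw [mul_pow]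
        ring
      _ = _ := by
        rw [div_mul_div_cancel₀ hu.ne', div_self hη.ne', one_pow, mul_one]
  have hconst : IntegrableOn (fun _ ↦ C) (Metric.ball x₀ r) μ :=
    integrableOn_const measure_ball_lt_top.ne
  have hmono := setIntegral_mono_ae_restrict hFint
    (hconst.sub (hint.const_mul (c / 2))) hle
  rw [hF0, integral_sub' hconst (hint.const_mul (c / 2)),
    integral_const_mul, setIntegral_const, smul_eq_mul] at hmono
  rw [le_div_iff₀ (by positivity)]
  linarith

theorem image_closedBall_mem_nhds_of_lt_det_fderiv {E : Type*} [NormedAddCommGroup E]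
    [InnerProductSpace ℝ E] [FiniteDimensional ℝ E] [Nontrivial E] [MeasurableSpace E]
    [BorelSpace E] (μ : Measure E) [μ.IsAddHaarMeasure] {ψ : E → E} {x₀ : E} {r : ℝ} (hr : 0 < r)
    {L : NNReal} (hψ : LipschitzOnWith L ψ (Metric.closedBall x₀ r)) {c : ℝ} (hc : 0 < c)
    (hjac : ∀ᵐ x ∂(μ.restrict (Metric.ball x₀ r)),
      DifferentiableAt ℝ ψ x ∧ c < (fderiv ℝ ψ x).det) :
    ψ '' Metric.closedBall x₀ r ∈ nhds (ψ x₀) := by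
  obtain ⟨C, hC0, hC⟩ := exists_setIntegral_pow_le_of_notMem_image μ hr hψ hc hjac
  set n := Module.finrank ℝ E with hn
  have hn0 : n ≠ 0 := Module.finrank_pos.ne'
  have hω : 0 < μ.real (Metric.ball 0 1) :=
    ENNReal.toReal_pos (Metric.measure_ball_pos μ _ one_pos).ne' measure_ball_lt_top.ne
  set ω := μ.real (Metric.ball (0 : E) 1)
  set a : ℝ := r ^ 2 / 2 / (L + 1) with ha
  have hL : (0 : ℝ) ≤ L := L.2
  have ha0 : 0 < a := by positivity
  refine Metric.mem_nhds_iff.2 ⟨min (min 1 (r / 2)) (a ^ (2 * n) * ω / C), by positivity, ?_⟩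
  intro y hyδ
  by_contra hy
  obtain ⟨hint, hle⟩ := hC y hy
  rw [Metric.mem_ball, lt_min_iff, lt_min_iff, lt_div_iff₀ hC0] at hyδ
  obtain ⟨⟨hδ1, hδr⟩, hδC⟩ := hyδ
  have hx₀ : x₀ ∈ Metric.closedBall x₀ r := Metric.mem_closedBall_self hr.le
  have hδ : 0 < dist y (ψ x₀) := dist_pos.2 fun h ↦ hy ⟨x₀, hx₀, h.symm⟩
  set δ := dist y (ψ x₀) with hδ_def
  have hsub : Metric.ball x₀ δ ⊆ Metric.ball x₀ r := Metric.ball_subset_ball (by linarith)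
  have hlow : ∀ x ∈ Metric.ball x₀ δ,
      (a / δ) ^ (2 * n) ≤ ((r ^ 2 - dist x x₀ ^ 2) / dist (ψ x) y) ^ (2 * n) := by
    intro x hx
    have hxr := Metric.ball_subset_closedBall (hsub hx)
    have hu : 0 < dist (ψ x) y := dist_pos.2 fun h ↦ hy ⟨x, hxr, h⟩
    have hxδ := (Metric.mem_ball.1 hx).le
    have h1 : dist (ψ x) y ≤ (L + 1) * δ := by
      have h2 := dist_triangle_right (ψ x) y (ψ x₀)
      have h3 := hψ.dist_le_mul x hxr x₀ hx₀
      have h4 : L * dist x x₀ ≤ L * δ := by gcongr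
      linarith
    have h2 : r ^ 2 / 2 ≤ r ^ 2 - dist x x₀ ^ 2 := by
      have : dist x x₀ ^ 2 ≤ (r / 2) ^ 2 := by
        gcongr
        linarith
      nlinarith
    rw [ha, div_div]
    gcongr
    exact le_trans (by positivity) h2
  have h1 : (a / δ) ^ (2 * n) * (δ ^ n * ω) ≤ C := by
    have hball : μ.real (Metric.ball x₀ δ) = δ ^ n * ω := by
      rw [measureReal_def, Measure.addHaar_ball μ x₀ hδ.le, ENNReal.toReal_mul,
        ENNReal.toReal_ofReal (by positivity)]
      rfl
    calc (a / δ) ^ (2 * n) * (δ ^ n * ω) = ∫ x in Metric.ball x₀ δ, (a / δ) ^ (2 * n) ∂μ := by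
          rw [setIntegral_const, smul_eq_mul, hball, mul_comm]
      _ ≤ ∫ x in Metric.ball x₀ δ,
          ((r ^ 2 - dist x x₀ ^ 2) / dist (ψ x) y) ^ (2 * n) ∂μ :=
        setIntegral_mono_on (integrableOn_const measure_ball_lt_top.ne) (hint.mono_set hsub)
          Metric.isOpen_ball.measurableSet hlow
      _ ≤ ∫ x in Metric.ball x₀ r,
          ((r ^ 2 - dist x x₀ ^ 2) / dist (ψ x) y) ^ (2 * n) ∂μ :=
        setIntegral_mono_set hint
          (Filter.Eventually.of_forall fun x ↦ (even_two_mul n).pow_nonneg _) hsub.eventuallyLE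
      _ ≤ C := hle
  have h2 : (a / δ) ^ (2 * n) * (δ ^ n * ω) = a ^ (2 * n) * ω / δ ^ n := by
    rw [div_pow, two_mul n, pow_add δ]
    field_simp
  rw [h2, div_le_iff₀ (by positivity)] at h1
  have h3 : δ ^ n ≤ δ := pow_le_of_le_one hδ.le hδ1.le hn0
  have h4 : C * δ ^ n ≤ C * δ := by gcongr
  linarith

/-- Openness part of Reshetnyak's theorem: a locally Lipschitz map on an open
set `U ⊆ ℝⁿ` whose Jacobian determinant is a.e. bounded below by `c > 0` is open. -/
theorem reshetnyak_open_map
    (n : ℕ) (hn : 1 ≤ n)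
    (U : Set (EuclideanSpace ℝ (Fin n))) (hU : IsOpen U)
    (ψ : EuclideanSpace ℝ (Fin n) → EuclideanSpace ℝ (Fin n))
    (hlip : ∀ x ∈ U, ∃ K : NNReal, ∃ t ∈ nhds x, t ⊆ U ∧ LipschitzOnWith K ψ t)
    (c : ℝ) (hc : 0 < c)
    (hjac : ∀ᵐ x ∂(volume.restrict U),
      DifferentiableAt ℝ ψ x ∧ c < (fderiv ℝ ψ x).det) :
    ∀ V : Set (EuclideanSpace ℝ (Fin n)), V ⊆ U → IsOpen V → IsOpen (ψ '' V) := by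
  intro V hVU hV
  have : Nonempty (Fin n) := ⟨⟨0, hn⟩⟩
  rw [isOpen_iff_mem_nhds]
  rintro _ ⟨x, hx, rfl⟩
  obtain ⟨K, t, ht, -, hK⟩ := hlip x (hVU hx)
  obtain ⟨r, hr, hrt⟩ := Metric.nhds_basis_closedBall.mem_iff.1
    (Filter.inter_mem ht (hV.mem_nhds hx))
  have hrV : Metric.closedBall x r ⊆ V := hrt.trans Set.inter_subset_right
  refine Filter.mem_of_superset (image_closedBall_mem_nhds_of_lt_det_fderiv volume hr
    (hK.mono (hrt.trans Set.inter_subset_left)) hc ?_) (Set.image_mono hrV)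
  exact ae_restrict_of_ae_restrict_of_subset
    (Metric.ball_subset_closedBall.trans (hrV.trans hVU)) hjac
end

section
/- Let n ≥ 1, let U ⊆ ℝⁿ be an open set, and let ψ : U → ℝⁿ be a locally Lipschitz map. Suppose there exists a constant c > 0 such that for almost every x ∈ U, ψ is differentiable at x and det Dψ(x) > c. Then there exists an open set V ⊆ U with vol(U \ V) = 0 such that ψ is a local homeomorphism at every point of V: for each x ∈ V there is an open neighborhood W of x with W ⊆ U such that ψ restricted to W is a homeomorphism onto an open subset of ℝⁿ. -/
open MeasureTheory

section DegreeTheory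

open Metric Set Filter
open scoped Topology NNReal

set_option linter.unusedSectionVars false

variable {E : Type*} [NormedAddCommGroup E] [InnerProductSpace ℝ E] [FiniteDimensional ℝ E]
  [MeasurableSpace E] [BorelSpace E]

lemma integrableOn_det_of_bounded (μ : Measure E) {s : Set E} (hs : μ s ≠ ⊤)
    {f : E → E →L[ℝ] E} (hf : Measurable f) {C : ℝ} (hC : ∀ x, ‖f x‖ ≤ C) :
    IntegrableOn (fun x => (f x).det) s μ := by
  obtain ⟨M, hM⟩ := (isCompact_closedBall (0 : E →L[ℝ] E) C).exists_bound_of_continuousOn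
    (f := fun A : E →L[ℝ] E => A.det) ContinuousLinearMap.continuous_det.continuousOn
  refine Measure.integrableOn_of_bounded hs
    (ContinuousLinearMap.continuous_det.measurable.comp hf).aestronglyMeasurable (M := M)
    (Eventually.of_forall fun x => hM _ ?_)
  simpa using hC x

lemma LipschitzWith.integrableOn_det_fderiv (μ : Measure E) {s : Set E} (hs : μ s ≠ ⊤)
    {g : E → E} {K : ℝ≥0} (hg : LipschitzWith K g) :
    IntegrableOn (fun x => (fderiv ℝ g x).det) s μ :=
  integrableOn_det_of_bounded μ hs (measurable_fderiv ℝ g)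
    fun _ => norm_fderiv_le_of_lipschitz ℝ hg

lemma eventually_integral_det_one_add_smul_fderiv (μ : Measure E) [μ.IsAddHaarMeasure]
    {v : E → E} {K : ℝ≥0} (hv : LipschitzWith K v) {p : E} {R : ℝ}
    (h0 : ∀ x ∉ ball p R, v x = 0) :
    ∀ᶠ t : ℝ in 𝓝[>] 0,
      ∫ x in ball p R, (1 + t • fderiv ℝ v x).det ∂μ = μ.real (ball p R) := by
  obtain ⟨δ, hδ, hδ0⟩ := ((addHaar_image_le_mul_of_det_lt μ (1 : E →L[ℝ] E) (m := 2)
    (by simp [ContinuousLinearMap.det])).and self_mem_nhdsWithin).exists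
  obtain ⟨ε, hε, hdet⟩ : ∃ ε > 0, ∀ M : E →L[ℝ] E, ‖M‖ < ε → 0 < (1 + M).det := by
    have hc : Continuous fun M : E →L[ℝ] E => (1 + M).det :=
      ContinuousLinearMap.continuous_det.comp (continuous_const.add continuous_id)
    have : ∀ᶠ M : E →L[ℝ] E in 𝓝 0, 0 < (1 + M).det :=
      hc.continuousAt.eventually (lt_mem_nhds (by simp [ContinuousLinearMap.det]))
    obtain ⟨ε, hε, h⟩ := Metric.eventually_nhds_iff.1 this
    exact ⟨ε, hε, fun M hM => h (by simpa using hM)⟩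
  have hlim : Tendsto (fun t : ℝ => t * K) (𝓝[>] 0) (𝓝 0) := by
    have : Tendsto (fun t : ℝ => t * K) (𝓝 0) (𝓝 (0 * K)) := tendsto_id.mul_const _
    rw [zero_mul] at this
    exact this.mono_left nhdsWithin_le_nhds
  filter_upwards [hlim.eventually (gt_mem_nhds one_pos), hlim.eventually (gt_mem_nhds hε),
    hlim.eventually (gt_mem_nhds (show (0 : ℝ) < δ from hδ0)), self_mem_nhdsWithin]
    with t h1 h2 h3 ht
  have ht : 0 < t := ht
  set g : E → E := fun x => x + t • v x with hg
  have happ : ApproximatesLinearOn g ((ContinuousLinearEquiv.refl ℝ E : E ≃L[ℝ] E) : E →L[ℝ] E)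
      univ (t.toNNReal * K) := by
    intro x _ y _
    have : g x - g y - ((ContinuousLinearEquiv.refl ℝ E : E ≃L[ℝ] E) : E →L[ℝ] E) (x - y)
        = t • (v x - v y) := by
      simp only [hg, smul_sub, ContinuousLinearEquiv.coe_coe, ContinuousLinearEquiv.coe_refl',
        id_eq]
      abel
    rw [this, norm_smul, Real.norm_of_nonneg ht.le, NNReal.coe_mul, Real.coe_toNNReal _ ht.le,
      mul_assoc]
    gcongr
    exact hv.norm_sub_le x y
  have hcond : Subsingleton E ∨ t.toNNReal * K <
      ‖((ContinuousLinearEquiv.refl ℝ E : E ≃L[ℝ] E).symm : E →L[ℝ] E)‖₊⁻¹ := by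
    rcases subsingleton_or_nontrivial E with h | h
    · exact Or.inl h
    · right
      have : ‖((ContinuousLinearEquiv.refl ℝ E : E ≃L[ℝ] E).symm : E →L[ℝ] E)‖₊ = 1 := by
        have : ((ContinuousLinearEquiv.refl ℝ E : E ≃L[ℝ] E).symm : E →L[ℝ] E)
            = ContinuousLinearMap.id ℝ E := rfl
        rw [this]
        exact ContinuousLinearMap.nnnorm_id
      rw [this, inv_one, ← NNReal.coe_lt_coe]
      simpa [ht.le] using h1
  have hinj : Function.Injective g := injOn_univ.1 (injOn_iff_injective.2 (happ.injective hcond))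
  have hsurj : Function.Surjective g := happ.surjective hcond
  have hout : ∀ x ∉ ball p R, g x = x := fun x hx => by simp [hg, h0 x hx]
  have himage : g '' ball p R = ball p R := by
    ext y
    constructor
    · rintro ⟨x, hx, rfl⟩
      by_contra hy
      rw [hinj (hout _ hy)] at hy
      exact hy hx
    · intro hy
      obtain ⟨x, rfl⟩ := hsurj y
      refine ⟨x, ?_, rfl⟩
      by_contra hx
      exact hx (hout x hx ▸ hy)
  set D : Set E := {x | DifferentiableAt ℝ v x}
  have hDm : MeasurableSet D := measurableSet_of_differentiableAt ℝ v
  have hD0 : μ Dᶜ = 0 := hv.ae_differentiableAt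
  have hgD : μ (g '' Dᶜ) = 0 := by
    refine le_antisymm ((hδ _ g ?_).trans (by simp [hD0])) zero_le
    intro x _ y _
    refine (happ x (mem_univ _) y (mem_univ _)).trans ?_
    gcongr
    rw [← NNReal.coe_le_coe]
    simpa [ht.le] using h3.le
  have hvol : μ (g '' (ball p R ∩ D)) = μ (ball p R) := by
    apply le_antisymm
    · exact measure_mono ((image_mono inter_subset_left).trans himage.subset)
    · calc μ (ball p R) = μ (g '' ball p R) := by rw [himage]
        _ ≤ μ (g '' (ball p R ∩ D) ∪ g '' Dᶜ) := by
            rw [← image_union]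
            refine measure_mono (image_mono fun x hx => ?_)
            by_cases h : x ∈ D
            · exact Or.inl ⟨hx, h⟩
            · exact Or.inr h
        _ ≤ _ := (measure_union_le _ _).trans (by simp [hgD])
  have hpos : ∀ x, 0 < (1 + t • fderiv ℝ v x).det := fun x => by
    refine hdet _ (lt_of_le_of_lt ?_ h2)
    rw [norm_smul, Real.norm_of_nonneg ht.le]
    gcongr
    exact norm_fderiv_le_of_lipschitz ℝ hv
  have harea := lintegral_abs_det_fderiv_eq_addHaar_image μ (s := ball p R ∩ D) (f := g)
    (f' := fun x => 1 + t • fderiv ℝ v x) (measurableSet_ball.inter hDm)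
    (fun x hx => ((hasFDerivAt_id x).add (hx.2.hasFDerivAt.const_smul t)).hasFDerivWithinAt)
    hinj.injOn
  have hset : (ball p R : Set E) =ᵐ[μ] (ball p R ∩ D : Set E) := by
    have : D =ᵐ[μ] (univ : Set E) := eventuallyEq_univ.2 hv.ae_differentiableAt
    simpa using ((ae_eq_refl (ball p R)).inter this).symm
  rw [setIntegral_congr_set hset, integral_eq_lintegral_of_nonneg_ae
    (Eventually.of_forall fun x => (hpos x).le)
    (ContinuousLinearMap.continuous_det.measurable.comp
      (measurable_const.add ((measurable_fderiv ℝ v).const_smul t))).aestronglyMeasurable,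
    Measure.real, ← hvol, ← harea]
  simp only [abs_of_pos (hpos _)]

/-- `t ↦ det (1 + t M)` is a polynomial of degree at most the dimension. -/
lemma exists_polynomial_det_one_add_smul (M : E →L[ℝ] E) :
    ∃ P : Polynomial ℝ, P.natDegree ≤ Module.finrank ℝ E ∧
      ∀ t : ℝ, P.eval t = (1 + t • M).det := by
  classical
  let b := Module.finBasis ℝ E
  set A := LinearMap.toMatrix b b (M : E →ₗ[ℝ] E)
  refine ⟨((Polynomial.X : Polynomial ℝ) • A.map Polynomial.C
    + (1 : Matrix _ _ ℝ).map Polynomial.C).det, ?_, fun t => ?_⟩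
  · simpa using Polynomial.natDegree_det_X_add_C_le A 1
  · have : (1 + t • M).det = (1 + t • A).det := by
      have h : ((1 + t • M : E →L[ℝ] E) : E →ₗ[ℝ] E) = 1 + t • (M : E →ₗ[ℝ] E) := rfl
      rw [ContinuousLinearMap.det, h, ← LinearMap.det_toMatrix b]
      simp [A, LinearMap.toMatrix_one]
    rw [this, ← Polynomial.coe_evalRingHom, RingHom.map_det]
    congr 1
    ext i j
    by_cases hij : i = j <;> simp [hij] <;> ring

/-- A compactly supported Lipschitz perturbation of the identity has degree one. -/
lemma integral_det_fderiv_id_add (μ : Measure E) [μ.IsAddHaarMeasure]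
    {v : E → E} {K : ℝ≥0} (hv : LipschitzWith K v) {p : E} {R : ℝ}
    (h0 : ∀ x ∉ ball p R, v x = 0) :
    ∫ x in ball p R, (fderiv ℝ (fun y => y + v y) x).det ∂μ = μ.real (ball p R) := by
  classical
  obtain ⟨ε, hε, hsmall⟩ := mem_nhdsGT_iff_exists_Ioo_subset.1
    (eventually_integral_det_one_add_smul_fderiv μ hv h0)
  have hε : 0 < ε := hε
  set s := Finset.range (Module.finrank ℝ E + 1)
  set w : ℕ → ℝ := fun i => ε / (i + 2) with hw
  have hwinj : InjOn w s := by
    intro i _ j _ hij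
    have hij : ε / ((i : ℝ) + 2) = ε / ((j : ℝ) + 2) := hij
    have h1 : (i : ℝ) + 2 ≠ 0 := by positivity
    have h2 : (j : ℝ) + 2 ≠ 0 := by positivity
    field_simp at hij
    exact_mod_cast (add_right_cancel hij).symm
  have hwI : ∀ i, w i ∈ Ioo 0 ε := fun i => by
    refine ⟨by positivity, div_lt_self hε ?_⟩
    have : (0 : ℝ) ≤ i := by positivity
    linarith
  have hpt : ∀ M : E →L[ℝ] E, (1 + M).det =
      ∑ i ∈ s, (1 + w i • M).det * (Lagrange.basis s w i).eval 1 := by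
    intro M
    obtain ⟨P, hP, hPe⟩ := exists_polynomial_det_one_add_smul M
    have hdeg : P.degree < s.card := by
      refine (Polynomial.degree_le_natDegree).trans_lt ?_
      rw [Finset.card_range]
      exact_mod_cast Nat.lt_succ_of_le hP
    have h := congrArg (Polynomial.eval 1) (Lagrange.eq_interpolate hwinj hdeg)
    rw [Lagrange.interpolate_apply, Polynomial.eval_finsetSum] at h
    simpa [hPe] using h
  have hsum : ∑ i ∈ s, (Lagrange.basis s w i).eval 1 = 1 := by
    rw [← Polynomial.eval_finsetSum, Lagrange.sum_basis hwinj ⟨0, by simp [s]⟩,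
      Polynomial.eval_one]
  calc ∫ x in ball p R, (fderiv ℝ (fun y => y + v y) x).det ∂μ
      = ∫ x in ball p R, (1 + fderiv ℝ v x).det ∂μ := by
        refine integral_congr_ae (ae_restrict_of_ae ?_)
        filter_upwards [hv.ae_differentiableAt (μ := μ)] with x hx
        have h : HasFDerivAt (fun y => y + v y) (1 + fderiv ℝ v x) x :=
          (hasFDerivAt_id x).add hx.hasFDerivAt
        rw [h.fderiv]
    _ = ∑ i ∈ s, (∫ x in ball p R, (1 + w i • fderiv ℝ v x).det ∂μ)
          * (Lagrange.basis s w i).eval 1 := by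
        simp_rw [hpt (fderiv ℝ v _), ← integral_mul_const]
        refine integral_finsetSum _ fun i _ => Integrable.mul_const ?_ _
        refine integrableOn_det_of_bounded μ measure_ball_lt_top.ne
          (measurable_const.add ((measurable_fderiv ℝ v).const_smul (w i)))
          (C := ‖(1 : E →L[ℝ] E)‖ + ‖w i‖ * K) fun x => ?_
        refine (norm_add_le _ _).trans ?_
        rw [norm_smul]
        gcongr
        exact norm_fderiv_le_of_lipschitz ℝ hv
    _ = ∑ i ∈ s, μ.real (ball p R) * (Lagrange.basis s w i).eval 1 :=
        Finset.sum_congr rfl fun i _ => by rw [hsmall (hwI i)]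
    _ = μ.real (ball p R) := by rw [← Finset.mul_sum, hsum, mul_one]

lemma exists_lipschitz_cutoff (p : E) {r R : ℝ} (hr : r < R) :
    ∃ χ : E → ℝ, ∃ a : ℝ≥0, LipschitzWith a χ ∧ (∀ x, χ x ∈ Icc (0 : ℝ) 1) ∧
      (∀ x ∈ ball p r, χ x = 1) ∧ ∀ x ∉ ball p R, χ x = 0 := by
  have hd : 0 < R - r := sub_pos.2 hr
  refine ⟨fun x => thickenedIndicator hd (ball p r) x, (R - r).toNNReal⁻¹, ?_, fun x => ⟨?_, ?_⟩,
    fun x hx => ?_, fun x hx => ?_⟩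
  · exact lipschitzWith_thickenedIndicator hd _
  · exact NNReal.coe_nonneg _
  · exact_mod_cast thickenedIndicator_le_one hd _ x
  · exact NNReal.coe_eq_one.2 (thickenedIndicator_one hd _ hx)
  · refine NNReal.coe_eq_zero.2 (thickenedIndicator_zero hd _ ?_)
    rw [mem_thickening_iff]
    rintro ⟨z, hz, hxz⟩
    refine hx (mem_ball.2 ?_)
    have := dist_triangle x z p
    have := mem_ball.1 hz
    linarith

lemma LipschitzWith.smul_of_bounded_on_support {χ : E → ℝ} {u : E → E} {a b M : ℝ≥0}
    (hχ : LipschitzWith a χ) (hχ1 : ∀ x, χ x ∈ Icc (0 : ℝ) 1) (hu : LipschitzWith b u)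
    (hM : ∀ x, χ x ≠ 0 → ‖u x‖ ≤ M) : LipschitzWith (a * M + b) fun x => χ x • u x := by
  have key : ∀ x z, χ x ≠ 0 →
      ‖χ x • u x - χ z • u z‖ ≤ (a * M + b : ℝ≥0) * ‖x - z‖ := by
    intro x z hx
    calc ‖χ x • u x - χ z • u z‖ = ‖(χ x - χ z) • u x + χ z • (u x - u z)‖ := by
          congr 1; rw [sub_smul, smul_sub]; abel
      _ ≤ ‖χ x - χ z‖ * ‖u x‖ + ‖χ z‖ * ‖u x - u z‖ := by
          rw [← norm_smul, ← norm_smul]; exact norm_add_le _ _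
      _ ≤ (a * ‖x - z‖) * M + 1 * (b * ‖x - z‖) := by
          gcongr
          · exact hχ.norm_sub_le x z
          · exact hM x hx
          · rw [Real.norm_of_nonneg (hχ1 z).1]; exact (hχ1 z).2
          · exact hu.norm_sub_le x z
      _ = _ := by push_cast; ring
  refine LipschitzWith.of_dist_le_mul fun x z => ?_
  simp only [dist_eq_norm]
  by_cases hx : χ x = 0
  · by_cases hz : χ z = 0
    · simp only [hx, hz, zero_smul, sub_zero, norm_zero]
      positivity
    · rw [norm_sub_rev, norm_sub_rev x]
      exact key z x hz
  · exact key x z hx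

/-- The integral of the Jacobian over a ball depends only on the values outside the ball. -/
lemma integral_det_fderiv_eq_of_eq_off_ball (μ : Measure E) [μ.IsAddHaarMeasure]
    {f g : E → E} {K L : ℝ≥0} (hf : LipschitzWith K f) (hg : LipschitzWith L g) {p : E} {r : ℝ}
    (hfg : ∀ x ∉ ball p r, f x = g x) :
    ∫ x in ball p r, (fderiv ℝ f x).det ∂μ = ∫ x in ball p r, (fderiv ℝ g x).det ∂μ := by
  rcases subsingleton_or_nontrivial E with h | h
  · rw [Subsingleton.elim f g]
  obtain ⟨χ, a, hχ, hχ1, hχr, hχR⟩ := exists_lipschitz_cutoff p (lt_add_one r)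
  have ext_id : ∀ (w : E → E) (C : ℝ≥0), LipschitzWith C w →
      (∃ C', LipschitzWith C' fun x => χ x • (w x - x)) ∧
      ∫ x in ball p (r + 1), (fderiv ℝ (fun y => y + χ y • (w y - y)) x).det ∂μ
        = μ.real (ball p (r + 1)) := by
    intro w C hw
    have hu : LipschitzWith (C + 1) fun x => w x - x := hw.sub LipschitzWith.id
    obtain ⟨M, hM⟩ := (isCompact_closedBall p (r + 1)).exists_bound_of_continuousOn
      hu.continuous.continuousOn
    have hv := hχ.smul_of_bounded_on_support hχ1 hu (M := M.toNNReal) fun x hx =>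
      (hM x (ball_subset_closedBall (by_contra fun h => hx (hχR x h)))).trans
        (Real.le_coe_toNNReal M)
    exact ⟨⟨_, hv⟩, integral_det_fderiv_id_add μ hv fun x hx => by simp [hχR x hx]⟩
  obtain ⟨⟨C₁, h₁⟩, e₁⟩ := ext_id f K hf
  obtain ⟨⟨C₂, h₂⟩, e₂⟩ := ext_id g L hg
  set F : E → E := fun y => y + χ y • (f y - y)
  set G : E → E := fun y => y + χ y • (g y - y)
  have hF : LipschitzWith (1 + C₁) F := LipschitzWith.id.add h₁
  have hG : LipschitzWith (1 + C₂) G := LipschitzWith.id.add h₂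
  have iF : ∀ ρ, IntegrableOn (fun x => (fderiv ℝ F x).det) (ball p ρ) μ := fun ρ =>
    hF.integrableOn_det_fderiv μ measure_ball_lt_top.ne
  have iG : ∀ ρ, IntegrableOn (fun x => (fderiv ℝ G x).det) (ball p ρ) μ := fun ρ =>
    hG.integrableOn_det_fderiv μ measure_ball_lt_top.ne
  have hoff : ∀ᵐ x ∂μ, x ∈ ball p (r + 1) \ ball p r →
      (fderiv ℝ F x).det - (fderiv ℝ G x).det = 0 := by
    have hs : ∀ᵐ x ∂μ, x ∉ sphere p r := by
      exact measure_eq_zero_iff_ae_notMem.1 (Measure.addHaar_sphere μ p r)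
    filter_upwards [hs] with x hx hx'
    have hxc : x ∈ (closedBall p r)ᶜ := by
      intro hc
      rcases (mem_closedBall.1 hc).lt_or_eq with h | h
      · exact hx'.2 h
      · exact hx h
    have : F =ᶠ[𝓝 x] G := by
      filter_upwards [isClosed_closedBall.isOpen_compl.mem_nhds hxc] with y hy
      simp only [F, G, hfg y fun h => hy (ball_subset_closedBall h)]
    rw [this.fderiv_eq, sub_self]
  have hdiff : ∫ x in ball p r, ((fderiv ℝ F x).det - (fderiv ℝ G x).det) ∂μ = 0 := by
    rw [← setIntegral_eq_of_subset_of_ae_sdiff_eq_zero measurableSet_ball.nullMeasurableSet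
      (ball_subset_ball (le_add_of_nonneg_right zero_le_one)) hoff,
      integral_sub (iF _) (iG _), e₁, e₂, sub_self]
  rw [integral_sub (iF _) (iG _), sub_eq_zero] at hdiff
  have hin : ∀ w : E → E, ∫ x in ball p r, (fderiv ℝ (fun y => y + χ y • (w y - y)) x).det ∂μ
      = ∫ x in ball p r, (fderiv ℝ w x).det ∂μ := fun w => by
    refine setIntegral_congr_fun measurableSet_ball fun x hx => ?_
    have : (fun y => y + χ y • (w y - y)) =ᶠ[𝓝 x] w := by
      filter_upwards [isOpen_ball.mem_nhds hx] with y hy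
      simp [hχr y hy]
    simp only [this.fderiv_eq]
  rw [← hin f, ← hin g]
  exact hdiff

/-- The radial retraction onto the closed ball of radius `τ` around `y`. -/
noncomputable def radialRetraction (y : E) (τ : ℝ) (z : E) : E :=
  y + (τ / max τ ‖z - y‖) • (z - y)

lemma radialRetraction_of_mem_ball {y z : E} {τ : ℝ} (hz : z ∈ ball y τ) :
    radialRetraction y τ z = z := by
  have h : ‖z - y‖ < τ := mem_ball_iff_norm.1 hz
  have : 0 < τ := (norm_nonneg _).trans_lt h
  rw [radialRetraction, max_eq_left h.le, div_self this.ne', one_smul, add_sub_cancel]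

lemma norm_radialRetraction_sub_of_notMem_ball {y z : E} {τ : ℝ} (hτ : 0 < τ)
    (hz : z ∉ ball y τ) : ‖radialRetraction y τ z - y‖ = τ := by
  have h : τ ≤ ‖z - y‖ := not_lt.1 fun h => hz (mem_ball_iff_norm.2 h)
  have : 0 < ‖z - y‖ := hτ.trans_le h
  rw [radialRetraction, add_sub_cancel_left, max_eq_right h, norm_smul, norm_div, norm_norm,
    Real.norm_of_nonneg hτ.le, div_mul_cancel₀ _ this.ne']

lemma norm_radialRetraction_sub_le {y : E} {τ : ℝ} (hτ : 0 < τ) (z : E) :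
    ‖radialRetraction y τ z - y‖ ≤ τ := by
  by_cases hz : z ∈ ball y τ
  · rw [radialRetraction_of_mem_ball hz]
    exact (mem_ball_iff_norm.1 hz).le
  · exact (norm_radialRetraction_sub_of_notMem_ball hτ hz).le

lemma lipschitzWith_radialRetraction (y : E) {τ : ℝ} (hτ : 0 < τ) :
    LipschitzWith 2 (radialRetraction y τ) := by
  refine LipschitzWith.of_dist_le_mul fun u w => ?_
  set a := max τ ‖u - y‖ with ha
  set b := max τ ‖w - y‖ with hb
  have ha0 : 0 < a := hτ.trans_le (le_max_left _ _)
  have hb0 : 0 < b := hτ.trans_le (le_max_left _ _)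
  have hab : |b - a| ≤ ‖u - w‖ := by
    have h := abs_max_sub_max_le_abs ‖w - y‖ ‖u - y‖ τ
    rw [max_comm _ τ, max_comm _ τ] at h
    refine h.trans ((abs_norm_sub_norm_le _ _).trans_eq ?_)
    rw [sub_sub_sub_cancel_right, norm_sub_rev]
  have hsplit : radialRetraction y τ u - radialRetraction y τ w
      = (τ / a) • (u - w) + ((τ / a) * ((b - a) / b)) • (w - y) := by
    have : (τ / a) * ((b - a) / b) = τ / a - τ / b := by field_simp
    rw [this, radialRetraction, radialRetraction, ← ha, ← hb]
    module
  rw [dist_eq_norm, dist_eq_norm, hsplit]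
  have h1 : τ / a ≤ 1 := (div_le_one ha0).2 (le_max_left _ _)
  have h2 : ‖w - y‖ / b ≤ 1 := (div_le_one hb0).2 (le_max_right _ _)
  have h0 : 0 ≤ τ / a := by positivity
  calc _ ≤ τ / a * ‖u - w‖ + τ / a * |b - a| * (‖w - y‖ / b) := by
        refine (norm_add_le _ _).trans_eq ?_
        rw [norm_smul, norm_smul, norm_mul, Real.norm_of_nonneg h0, norm_div,
          Real.norm_of_nonneg hb0.le, Real.norm_eq_abs]
        ring
    _ ≤ 1 * ‖u - w‖ + 1 * ‖u - w‖ * 1 := by gcongr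
    _ = (2 : ℝ≥0) * ‖u - w‖ := by push_cast; ring

lemma det_fderiv_radialRetraction_comp_eq_zero {g : E → E} {y : E} {τ : ℝ} (hτ : 0 < τ) {x : E}
    (hx : g x ∉ ball y τ) : (fderiv ℝ (fun z => radialRetraction y τ (g z)) x).det = 0 := by
  set q : E → E := fun z => radialRetraction y τ (g z) with hq
  have hqx : ‖q x - y‖ = τ := norm_radialRetraction_sub_of_notMem_ball hτ hx
  by_contra hdet
  obtain ⟨u, hu⟩ := (ContinuousLinearMap.toContinuousLinearEquivOfDetNeZero _ hdet).surjective
    (q x - y)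
  have hu : fderiv ℝ q x u = q x - y := hu
  by_cases hd : DifferentiableAt ℝ q x
  · have hsq := (hd.hasFDerivAt.sub_const y).norm_sq
    have hmax : IsLocalMax (fun z => ‖q z - y‖ ^ 2) x := Eventually.of_forall fun z => by
      simp only [hqx]
      gcongr
      exact norm_radialRetraction_sub_le hτ _
    have h0 := congrArg (fun A : E →L[ℝ] ℝ => A u) (hsq.fderiv.symm.trans hmax.fderiv_eq_zero)
    have h0 : inner ℝ (q x - y) (fderiv ℝ q x u) = 0 := by simpa [inner_sub_left] using h0
    rw [hu, real_inner_self_eq_norm_sq, hqx] at h0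
    exact (pow_pos hτ 2).ne' h0
  · rw [fderiv_zero_of_not_differentiableAt hd, zero_apply] at hu
    rw [← hu, norm_zero] at hqx
    exact hτ.ne hqx

lemma integral_det_fderiv_radialRetraction_comp (μ : Measure E) {g : E → E} (hg : Continuous g)
    (y : E) {τ : ℝ} (hτ : 0 < τ) (p : E) (r : ℝ) :
    ∫ x in ball p r, (fderiv ℝ (fun z => radialRetraction y τ (g z)) x).det ∂μ
      = ∫ x in ball p r ∩ g ⁻¹' ball y τ, (fderiv ℝ g x).det ∂μ := by
  have ho : IsOpen (g ⁻¹' ball y τ) := isOpen_ball.preimage hg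
  rw [setIntegral_eq_of_subset_of_forall_sdiff_eq_zero measurableSet_ball
    (inter_subset_left : ball p r ∩ g ⁻¹' ball y τ ⊆ ball p r) fun x hx =>
      det_fderiv_radialRetraction_comp_eq_zero hτ fun h => hx.2 ⟨hx.1, h⟩]
  refine setIntegral_congr_fun (measurableSet_ball.inter ho.measurableSet) fun x hx => ?_
  have : (fun z => radialRetraction y τ (g z)) =ᶠ[𝓝 x] g := by
    filter_upwards [ho.mem_nhds hx.2] with z hz
    exact radialRetraction_of_mem_ball hz
  simp only [this.fderiv_eq]

/-- Conservation of the total Jacobian over a small target ball under perturbations supported in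
a ball of the source. -/
lemma integral_det_fderiv_preimage_ball_eq (μ : Measure E) [μ.IsAddHaarMeasure]
    {f g : E → E} {K L : ℝ≥0} (hf : LipschitzWith K f) (hg : LipschitzWith L g) {p : E} {r : ℝ}
    (hfg : ∀ x ∉ ball p r, f x = g x) (y : E) {τ : ℝ} (hτ : 0 < τ) :
    ∫ x in ball p r ∩ f ⁻¹' ball y τ, (fderiv ℝ f x).det ∂μ
      = ∫ x in ball p r ∩ g ⁻¹' ball y τ, (fderiv ℝ g x).det ∂μ := by
  rw [← integral_det_fderiv_radialRetraction_comp μ hf.continuous y hτ,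
    ← integral_det_fderiv_radialRetraction_comp μ hg.continuous y hτ]
  exact integral_det_fderiv_eq_of_eq_off_ball μ ((lipschitzWith_radialRetraction y hτ).comp hf)
    ((lipschitzWith_radialRetraction y hτ).comp hg) fun x hx => by
      simp only [Function.comp_apply, hfg x hx]

/-- The Jacobian of `G` integrates to the volume of the target over every ball in
`ball q ρ`. -/
def HasUnitDegreeOn (μ : Measure E) (G : E → E) (q : E) (ρ : ℝ) : Prop :=
  ∀ y : E, ∀ τ : ℝ, 0 < τ → ball y τ ⊆ ball q ρ →
    ∫ x in G ⁻¹' ball y τ, (fderiv ℝ G x).det ∂μ = μ.real (ball y τ)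

/-- Near a point of differentiability with positive Jacobian, a locally Lipschitz map agrees with
a globally Lipschitz map of degree one. -/
lemma exists_lipschitz_hasUnitDegreeOn (μ : Measure E) [μ.IsAddHaarMeasure] {ψ : E → E} {x₀ : E}
    {A : E →L[ℝ] E} (hd : HasFDerivAt ψ A x₀) (hA : 0 < A.det) {K : ℝ≥0} {s S : Set E}
    (hs : s ∈ 𝓝 x₀) (hL : LipschitzOnWith K ψ s) (hS : S ∈ 𝓝 x₀) :
    ∃ (G : E → E) (C : ℝ≥0) (r ρ : ℝ), LipschitzWith C G ∧ 0 < r ∧ 0 < ρ ∧ ball x₀ r ⊆ S ∧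
      EqOn G ψ (ball x₀ r) ∧ G ⁻¹' ball (ψ x₀) ρ ⊆ ball x₀ r ∧
      HasUnitDegreeOn μ G (ψ x₀) ρ := by
  obtain ⟨ψ', hψ', hψψ'⟩ := hL.extend_finite_dimension
  set C' := lipschitzExtensionConstant E * K
  obtain ⟨N, hN, hNA⟩ : ∃ N > 0, ∀ z, ‖z‖ ≤ N * ‖A z‖ := by
    let e := ContinuousLinearMap.toContinuousLinearEquivOfDetNeZero A hA.ne'
    refine ⟨‖(e.symm : E →L[ℝ] E)‖ + 1, by positivity, fun z => ?_⟩
    calc ‖z‖ = ‖(e.symm : E →L[ℝ] E) (A z)‖ := by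
          congr 1
          exact (e.symm_apply_apply z).symm
      _ ≤ ‖(e.symm : E →L[ℝ] E)‖ * ‖A z‖ := ContinuousLinearMap.le_opNorm _ _
      _ ≤ _ := by gcongr; linarith
  set ε := 1 / (4 * N) with hε
  have hε0 : 0 < ε := by positivity
  obtain ⟨R, hR, hRball⟩ := Metric.mem_nhds_iff.1
    (inter_mem (inter_mem hs hS) (hd.isLittleO.def hε0))
  obtain ⟨χ, a, hχ, hχ1, hχr, hχR⟩ := exists_lipschitz_cutoff x₀ (half_lt_self hR)
  set aff : E → E := fun x => A x + (ψ x₀ - A x₀) with haff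
  have haffL : LipschitzWith (‖A‖₊ + 0) aff := A.lipschitz.add (LipschitzWith.const _)
  have hu : LipschitzWith (C' + (‖A‖₊ + 0)) fun x => ψ' x - aff x := hψ'.sub haffL
  have hbound : ∀ x ∈ ball x₀ R, ‖ψ' x - aff x‖ ≤ ε * R := fun x hx => by
    have h1 := hRball hx
    have h2 : ‖ψ x - ψ x₀ - A (x - x₀)‖ ≤ ε * ‖x - x₀‖ := h1.2
    rw [← hψψ' h1.1.1]
    calc ‖ψ x - aff x‖ = ‖ψ x - ψ x₀ - A (x - x₀)‖ := by
          congr 1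
          simp only [haff, map_sub]
          abel
      _ ≤ ε * ‖x - x₀‖ := h2
      _ ≤ ε * R := by
          gcongr
          exact (mem_ball_iff_norm.1 hx).le
  have hsupp : ∀ x, χ x ≠ 0 → x ∈ ball x₀ R := fun x hx => by_contra fun h => hx (hχR x h)
  have hv := hχ.smul_of_bounded_on_support hχ1 hu (M := (ε * R).toNNReal) fun x hx =>
    (hbound x (hsupp x hx)).trans (Real.le_coe_toNNReal _)
  set G : E → E := fun x => aff x + χ x • (ψ' x - aff x) with hG
  have hGL := haffL.add hv
  have hGaff : ∀ x, ‖G x - aff x‖ ≤ ε * R := fun x => by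
    simp only [hG, add_sub_cancel_left, norm_smul]
    by_cases hx : χ x = 0
    · simp only [hx, norm_zero, zero_mul]
      positivity
    · calc ‖χ x‖ * ‖ψ' x - aff x‖ ≤ 1 * (ε * R) := by
            gcongr
            · rw [Real.norm_of_nonneg (hχ1 x).1]
              exact (hχ1 x).2
            · exact hbound x (hsupp x hx)
        _ = ε * R := one_mul _
  have hpre : ∀ x z, ‖z - aff x‖ ≤ ε * R → z ∈ ball (ψ x₀) (ε * R) → x ∈ ball x₀ (R / 2) := by
    intro x z hz hzb
    rw [mem_ball_iff_norm] at hzb ⊢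
    have h1 : ‖A (x - x₀)‖ < ε * R + ε * R := by
      have : A (x - x₀) = (z - ψ x₀) - (z - aff x) := by
        simp only [haff, map_sub]
        abel
      rw [this]
      exact (norm_sub_le _ _).trans_lt (add_lt_add_of_lt_of_le hzb hz)
    calc ‖x - x₀‖ ≤ N * ‖A (x - x₀)‖ := hNA _
      _ < N * (ε * R + ε * R) := by gcongr
      _ = R / 2 := by rw [hε]; field_simp; norm_num
  have hεR : 0 < ε * R := by positivity
  refine ⟨G, _, R / 2, ε * R, hGL, half_pos hR, hεR, fun x hx => ?_, fun x hx => ?_, fun x hx => ?_,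
    fun y τ hτ hy => ?_⟩
  · exact (hRball (ball_subset_ball (half_le_self hR.le) hx)).1.2
  · rw [hψψ' (hRball (ball_subset_ball (half_le_self hR.le) hx)).1.1]
    simp only [hG, hχr x hx, one_smul, add_sub_cancel]
  · exact hpre x (G x) (hGaff x) hx
  · have hsub : ball x₀ (R / 2) ⊆ ball x₀ R := ball_subset_ball (half_le_self hR.le)
    have h := integral_det_fderiv_preimage_ball_eq μ hGL haffL (p := x₀) (r := R)
      (fun x hx => by simp [hχR x hx]) y hτ
    have hinG : G ⁻¹' ball y τ ⊆ ball x₀ R := fun x hx => hsub (hpre x (G x) (hGaff x) (hy hx))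
    have hinaff : aff ⁻¹' ball y τ ⊆ ball x₀ R := fun x hx =>
      hsub (hpre x (aff x) (by rw [sub_self, norm_zero]; exact hεR.le) (hy hx))
    rw [← hG, inter_eq_self_of_subset_right hinG, inter_eq_self_of_subset_right hinaff] at h
    rw [h]
    have hfd : ∀ x, fderiv ℝ aff x = A := fun x => (A.hasFDerivAt.add_const _).fderiv
    have hvol : μ (aff ⁻¹' ball y τ) = ENNReal.ofReal |A.det⁻¹| * μ (ball y τ) := by
      have : aff ⁻¹' ball y τ
          = (A : E →ₗ[ℝ] E) ⁻¹' ((fun z => z + (ψ x₀ - A x₀)) ⁻¹' ball y τ) := rfl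
      rw [this, Measure.addHaar_preimage_linearMap μ hA.ne', measure_preimage_add_right]
    simp only [hfd, setIntegral_const, Measure.real, hvol, ENNReal.toReal_mul]
    rw [ENNReal.toReal_ofReal (abs_nonneg _), abs_of_pos (inv_pos.2 hA), smul_eq_mul,
      mul_right_comm, inv_mul_cancel₀ hA.ne', one_mul]

lemma mul_measureReal_le_setIntegral_of_ae {μ : Measure E} {T : Set E} (hT : MeasurableSet T)
    (hμ : μ T ≠ ⊤) {f : E → ℝ} (hf : IntegrableOn f T μ) {c : ℝ}
    (hc : ∀ᵐ x ∂μ, x ∈ T → c ≤ f x) : c * μ.real T ≤ ∫ x in T, f x ∂μ := by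
  rw [mul_comm, ← smul_eq_mul, ← setIntegral_const]
  exact setIntegral_mono_on_ae (integrableOn_const hμ) hf hT hc

lemma IsOpen.measureReal_pos_of_subset {μ : Measure E} [μ.IsAddHaarMeasure] {O T : Set E} {x : E}
    (hO : IsOpen O) (hx : x ∈ O) (hOT : O ⊆ T) (hT : μ T ≠ ⊤) : 0 < μ.real T :=
  ENNReal.toReal_pos ((hO.measure_pos μ ⟨x, hx⟩).trans_le (measure_mono hOT)).ne' hT

lemma finite_fiber_of_hasUnitDegreeOn (μ : Measure E) [μ.IsAddHaarMeasure] {G : E → E} {C : ℝ≥0}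
    (hG : LipschitzWith C G) {q x₀ y : E} {r ρ c : ℝ} (hc : 0 < c)
    (hsub : G ⁻¹' ball q ρ ⊆ ball x₀ r) (hdeg : HasUnitDegreeOn μ G q ρ)
    (hdet : ∀ᵐ x ∂μ, x ∈ ball x₀ r → c ≤ (fderiv ℝ G x).det) (hy : y ∈ ball q ρ) :
    (G ⁻¹' {y}).Finite := by
  by_contra hinf
  set d := Module.finrank ℝ E
  obtain ⟨k, hk⟩ := exists_nat_gt (((C : ℝ) + 1) ^ d / c)
  obtain ⟨T, hTsub, hTk⟩ := Set.Infinite.exists_subset_card_eq hinf k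
  obtain ⟨δ, hδ, hyδ⟩ := Metric.isOpen_ball.mem_nhds hy |> Metric.mem_nhds_iff.1
  have hsep : ∀ᶠ σ : ℝ in 𝓝[>] 0, ∀ a ∈ T, ∀ b ∈ T, a ≠ b → σ + σ ≤ dist a b := by
    refine (eventually_all_finset T).2 fun a _ => (eventually_all_finset T).2 fun b _ => ?_
    by_cases hab : a = b
    · simp [hab]
    · have : ∀ᶠ σ : ℝ in 𝓝 0, σ + σ < dist a b := by
        have hcont : Tendsto (fun σ : ℝ => σ + σ) (𝓝 0) (𝓝 (0 + 0)) := tendsto_id.add tendsto_id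
        rw [add_zero] at hcont
        exact hcont.eventually (gt_mem_nhds (dist_pos.2 hab))
      filter_upwards [nhdsWithin_le_nhds this] with σ hσ _ using hσ.le
  have hsmall : ∀ᶠ σ : ℝ in 𝓝[>] 0, ((C : ℝ) + 1) * σ < δ := by
    have hcont : Tendsto (fun σ : ℝ => ((C : ℝ) + 1) * σ) (𝓝 0) (𝓝 (((C : ℝ) + 1) * 0)) :=
      tendsto_id.const_mul _
    rw [mul_zero] at hcont
    exact nhdsWithin_le_nhds (hcont.eventually (gt_mem_nhds hδ))
  obtain ⟨σ, ⟨hσsep, hσδ⟩, hσ⟩ := ((hsep.and hsmall).and self_mem_nhdsWithin).exists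
  have hσ : 0 < σ := hσ
  set τ := ((C : ℝ) + 1) * σ
  have hτ : 0 < τ := by positivity
  have hyτ : ball y τ ⊆ ball q ρ := (ball_subset_ball hσδ.le).trans hyδ
  have hPsub : G ⁻¹' ball y τ ⊆ ball x₀ r := (preimage_mono hyτ).trans hsub
  have hPfin : μ (G ⁻¹' ball y τ) ≠ ⊤ := measure_ne_top_of_subset hPsub measure_ball_lt_top.ne
  have hballs : ⋃ a ∈ T, ball a σ ⊆ G ⁻¹' ball y τ := by
    refine iUnion₂_subset fun a ha x hx => ?_
    have hGa : G a = y := hTsub ha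
    rw [mem_preimage, mem_ball, ← hGa]
    calc dist (G x) (G a) ≤ C * dist x a := hG.dist_le_mul _ _
      _ ≤ C * σ := by gcongr; exact (mem_ball.1 hx).le
      _ < τ := by simp only [τ]; linarith
  have hunion : μ.real (⋃ a ∈ T, ball a σ) = k * μ.real (ball (0 : E) σ) := by
    rw [measureReal_biUnion_finset
      (fun a ha b hb hab => ball_disjoint_ball (hσsep a ha b hb hab))
      (fun _ _ => measurableSet_ball) (fun _ _ => measure_ball_lt_top.ne)]
    simp only [Measure.addHaar_real_ball_center μ _ σ, Finset.sum_const, hTk, nsmul_eq_mul]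
  have h1 : c * μ.real (G ⁻¹' ball y τ) ≤ μ.real (ball y τ) := by
    rw [← hdeg y τ hτ hyτ]
    refine mul_measureReal_le_setIntegral_of_ae
      (isOpen_ball.preimage hG.continuous).measurableSet hPfin
      (hG.integrableOn_det_fderiv μ hPfin) ?_
    filter_upwards [hdet] with x hx hxP using hx (hPsub hxP)
  have h2 : k * μ.real (ball (0 : E) σ) ≤ μ.real (G ⁻¹' ball y τ) := by
    rw [← hunion]
    exact measureReal_mono hballs hPfin
  have h3 : μ.real (ball y τ) = ((C : ℝ) + 1) ^ d * μ.real (ball (0 : E) σ) := by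
    rw [Measure.real, Measure.addHaar_ball_mul_of_pos μ y (by positivity) σ, ENNReal.toReal_mul,
      ENNReal.toReal_ofReal (by positivity), Measure.real]
  have hpos : 0 < μ.real (ball (0 : E) σ) :=
    isOpen_ball.measureReal_pos_of_subset (mem_ball_self hσ) Subset.rfl measure_ball_lt_top.ne
  rw [div_lt_iff₀ hc] at hk
  have h4 : c * (k * μ.real (ball (0 : E) σ)) ≤ ((C : ℝ) + 1) ^ d * μ.real (ball (0 : E) σ) :=
    (mul_le_mul_of_nonneg_left h2 hc.le).trans (h1.trans_eq h3)
  have h5 := mul_lt_mul_of_pos_right hk hpos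
  linarith

/-- A Lipschitz map with Jacobian bounded below covers a neighbourhood of the image of any point
isolated in its fiber. -/
lemma image_closedBall_mem_nhds_of_isolated (μ : Measure E) [μ.IsAddHaarMeasure] {G : E → E}
    {C : ℝ≥0} (hG : LipschitzWith C G) {a : E} {s c : ℝ} (hs : 0 < s) (hc : 0 < c)
    (hdet : ∀ᵐ x ∂μ, x ∈ ball a s → c ≤ (fderiv ℝ G x).det)
    (hiso : ∀ x ∈ closedBall a s, G x = G a → x = a) :
    G '' closedBall a s ∈ 𝓝 (G a) := by
  obtain ⟨t, ht, htK⟩ : ∃ t > 0, ∀ x ∈ closedBall a s \ ball a (s / 2),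
      3 * t ≤ dist (G x) (G a) := by
    have hK : IsCompact (closedBall a s \ ball a (s / 2)) :=
      (isCompact_closedBall a s).diff isOpen_ball
    have hpos : ∀ x ∈ closedBall a s \ ball a (s / 2), 0 < dist (G x) (G a) := fun x hx =>
      dist_pos.2 fun h => hx.2 (hiso x hx.1 h ▸ mem_ball_self (half_pos hs))
    rcases (closedBall a s \ ball a (s / 2)).eq_empty_or_nonempty with h | h
    · exact ⟨1, one_pos, fun x hx => by simp [h] at hx⟩
    · obtain ⟨z, hz, hmin⟩ := hK.exists_isMinOn h
        (hG.continuous.dist continuous_const : Continuous fun x => dist (G x) (G a)).continuousOn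
      refine ⟨dist (G z) (G a) / 3, by linarith [hpos z hz], fun x hx => ?_⟩
      have := isMinOn_iff.1 hmin x hx
      linarith
  refine mem_of_superset (ball_mem_nhds (G a) ht) fun y hy => ?_
  by_contra hy'
  have hclosed : IsClosed (G '' closedBall a s) :=
    ((isCompact_closedBall a s).image hG.continuous).isClosed
  obtain ⟨τ₀, hτ₀, hτ₀sub⟩ := Metric.isOpen_iff.1 hclosed.isOpen_compl y hy'
  set τ := min τ₀ t
  have hτ : 0 < τ := lt_min hτ₀ ht
  obtain ⟨χ, l, hχ, hχ1, hχr, hχR⟩ := exists_lipschitz_cutoff a (half_lt_self hs)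
  set h := y - G a with hh
  have hht : ‖h‖ < t := mem_ball_iff_norm.1 hy
  set H : E → E := fun x => G x + χ x • h with hH
  have hHL : LipschitzWith (C + (l * ‖h‖₊ + 0)) H :=
    hG.add (hχ.smul_of_bounded_on_support hχ1 (LipschitzWith.const h) fun _ _ => le_rfl)
  set T := ball a s ∩ H ⁻¹' ball y τ
  have hTo : IsOpen T := isOpen_ball.inter (isOpen_ball.preimage hHL.continuous)
  have hTfin : μ T ≠ ⊤ := measure_ne_top_of_subset inter_subset_left measure_ball_lt_top.ne
  have haT : a ∈ T := by
    refine ⟨mem_ball_self hs, ?_⟩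
    have : H a = y := by simp [hH, hχr a (mem_ball_self (half_pos hs)), hh]
    rw [mem_preimage, this]
    exact mem_ball_self hτ
  have hTsub : T ⊆ ball a (s / 2) := by
    intro x hx
    by_contra hx'
    have h1 := htK x ⟨ball_subset_closedBall hx.1, hx'⟩
    have h2 : ‖H x - y‖ < t := (mem_ball_iff_norm.1 hx.2).trans_le (min_le_right _ _)
    have h3 : ‖χ x • h‖ ≤ ‖h‖ := by
      rw [norm_smul, Real.norm_of_nonneg (hχ1 x).1]
      exact mul_le_of_le_one_left (norm_nonneg _) (hχ1 x).2
    have h4 : dist (G x) (G a) ≤ ‖H x - y‖ + ‖h‖ + ‖χ x • h‖ := by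
      rw [dist_eq_norm]
      have : G x - G a = (H x - y) + h - χ x • h := by
        simp only [hH, hh]
        abel
      rw [this]
      exact (norm_sub_le _ _).trans (add_le_add_left (norm_add_le _ _) _)
    linarith
  have hzero : ∫ x in T, (fderiv ℝ H x).det ∂μ = 0 := by
    rw [integral_det_fderiv_preimage_ball_eq μ hHL hG
      (fun x hx => by simp [hH, hχR x hx]) y hτ]
    have : ball a s ∩ G ⁻¹' ball y τ = ∅ := by
      refine eq_empty_of_forall_notMem fun x hx => ?_
      exact hτ₀sub (ball_subset_ball (min_le_left _ _) hx.2)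
        (mem_image_of_mem G (ball_subset_closedBall hx.1))
    rw [this, setIntegral_empty]
  have hge : c * μ.real T ≤ ∫ x in T, (fderiv ℝ H x).det ∂μ := by
    refine mul_measureReal_le_setIntegral_of_ae hTo.measurableSet hTfin
      (hHL.integrableOn_det_fderiv μ hTfin) ?_
    filter_upwards [hdet] with x hx hxT
    have : H =ᶠ[𝓝 x] fun z => G z + h := by
      filter_upwards [isOpen_ball.mem_nhds (hTsub hxT)] with z hz
      simp [hH, hχr z hz]
    rw [this.fderiv_eq, fderiv_add_const]
    exact hx hxT.1
  have := mul_pos hc (hTo.measureReal_pos_of_subset haT Subset.rfl hTfin)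
  linarith

lemma exists_isolating_closedBall {G : E → E} {O : Set E} (hO : IsOpen O) {a : E} (ha : a ∈ O)
    (hfin : (G ⁻¹' {G a}).Finite) :
    ∀ᶠ s : ℝ in 𝓝[>] 0, closedBall a s ⊆ O ∧ ∀ x ∈ closedBall a s, G x = G a → x = a := by
  have hN : O ∩ (G ⁻¹' {G a} \ {a})ᶜ ∈ 𝓝 a :=
    inter_mem (hO.mem_nhds ha)
      ((hfin.subset sdiff_subset).isClosed.isOpen_compl.mem_nhds fun h => h.2 rfl)
  obtain ⟨ε, hε, hsub⟩ := Metric.mem_nhds_iff.1 hN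
  filter_upwards [nhdsWithin_le_nhds (gt_mem_nhds hε)] with s hs
  have hs' := closedBall_subset_ball (x := a) hs
  exact ⟨fun x hx => (hsub (hs' hx)).1,
    fun x hx hGx => by_contra fun hne => (hsub (hs' hx)).2 ⟨hGx, hne⟩⟩

/-- A locally Lipschitz map whose Jacobian is bounded below restricts to an open embedding near
any point of differentiability. -/
lemma exists_isOpenEmbedding_restrict (μ : Measure E) [μ.IsAddHaarMeasure] {ψ : E → E} {x₀ : E}
    {U : Set E} (hU : IsOpen U) (hx₀ : x₀ ∈ U) {K : ℝ≥0} {s₀ : Set E} (hs₀ : s₀ ∈ 𝓝 x₀)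
    (hL : LipschitzOnWith K ψ s₀) {c : ℝ} (hc : 0 < c)
    (hjac : ∀ᵐ x ∂μ, x ∈ U → DifferentiableAt ℝ ψ x ∧ c < (fderiv ℝ ψ x).det)
    (hd : DifferentiableAt ℝ ψ x₀) (hdet₀ : c < (fderiv ℝ ψ x₀).det) :
    ∃ W : Set E, IsOpen W ∧ x₀ ∈ W ∧ W ⊆ U ∧ Topology.IsOpenEmbedding (W.restrict ψ) := by
  obtain ⟨G, C, r, ρ, hG, hr, hρ, hrU, hGψ, hΩ, hdeg⟩ :=
    exists_lipschitz_hasUnitDegreeOn μ hd.hasFDerivAt (hc.trans hdet₀) hs₀ hL (hU.mem_nhds hx₀)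
  set q := ψ x₀
  have hGd : ∀ᵐ x ∂μ, x ∈ ball x₀ r → DifferentiableAt ℝ G x ∧ c ≤ (fderiv ℝ G x).det := by
    filter_upwards [hjac] with x hx hxr
    have he : G =ᶠ[𝓝 x] ψ := hGψ.eventuallyEq_of_mem (isOpen_ball.mem_nhds hxr)
    rw [he.fderiv_eq]
    exact ⟨he.differentiableAt_iff.2 (hx (hrU hxr)).1, (hx (hrU hxr)).2.le⟩
  have hGdet : ∀ᵐ x ∂μ, x ∈ ball x₀ r → c ≤ (fderiv ℝ G x).det :=
    hGd.mono fun x hx hxr => (hx hxr).2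
  set Ω := G ⁻¹' ball q ρ
  have hΩo : IsOpen Ω := isOpen_ball.preimage hG.continuous
  have hfin : ∀ a ∈ Ω, (G ⁻¹' {G a}).Finite := fun a ha =>
    finite_fiber_of_hasUnitDegreeOn μ hG hc hΩ hdeg hGdet ha
  have hnhds : ∀ a ∈ Ω, ∀ s > 0, closedBall a s ⊆ Ω →
      (∀ x ∈ closedBall a s, G x = G a → x = a) → G '' closedBall a s ∈ 𝓝 (G a) :=
    fun a ha s hs hsub hiso => image_closedBall_mem_nhds_of_isolated μ hG hs hc
      (hGdet.mono fun x hx hxs => hx (hΩ (hsub (ball_subset_closedBall hxs)))) hiso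
  have hopen : ∀ O ⊆ Ω, IsOpen O → IsOpen (G '' O) := by
    intro O hO hOo
    rw [isOpen_iff_mem_nhds]
    rintro _ ⟨a, ha, rfl⟩
    obtain ⟨s, ⟨hsO, hiso⟩, hs⟩ := ((exists_isolating_closedBall hOo ha (hfin a (hO ha))).and
      self_mem_nhdsWithin).exists
    exact mem_of_superset (hnhds a (hO ha) s hs (hsO.trans hO) hiso) (image_mono hsO)
  have hinj : InjOn G Ω := by
    intro a ha b hb hab
    by_contra hne
    obtain ⟨Oa, Ob, hOa, hOb, haO, hbO, hdisj⟩ := t2_separation hne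
    have hI : IsOpen (G '' (Oa ∩ Ω)) := hopen _ inter_subset_right (hOa.inter hΩo)
    have hQ : IsOpen (Ob ∩ Ω ∩ G ⁻¹' (G '' (Oa ∩ Ω))) :=
      (hOb.inter hΩo).inter (hI.preimage hG.continuous)
    obtain ⟨b', ⟨⟨hb'O, hb'Ω⟩, a', ⟨ha'O, ha'Ω⟩, hab'⟩, hb'd⟩ :
        ∃ b' ∈ Ob ∩ Ω ∩ G ⁻¹' (G '' (Oa ∩ Ω)),
          b' ∈ ball x₀ r → DifferentiableAt ℝ G b' ∧ c ≤ (fderiv ℝ G b').det := by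
      have hdense := Measure.dense_of_ae hGd
      exact hdense.inter_open_nonempty _ hQ ⟨b, ⟨hbO, hb⟩, a, ⟨haO, ha⟩, hab⟩
    obtain ⟨hb'd, hb'det⟩ := hb'd (hΩ hb'Ω)
    obtain ⟨G', C', r', ρ', hG', hr', hρ', hr'O, hG'G, hΩ', hdeg'⟩ :=
      exists_lipschitz_hasUnitDegreeOn μ hb'd.hasFDerivAt (hc.trans_le hb'det) univ_mem
        (hG.lipschitzOnWith (s := univ)) ((hOb.inter hΩo).mem_nhds ⟨hb'O, hb'Ω⟩)
    obtain ⟨ε, hε, hεsub⟩ := Metric.isOpen_iff.1 isOpen_ball (G b') hb'Ω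
    set τ := min ε ρ'
    have hτ : 0 < τ := lt_min hε hρ'
    have hτq : ball (G b') τ ⊆ ball q ρ := (ball_subset_ball (min_le_left _ _)).trans hεsub
    have hτρ' : ball (G b') τ ⊆ ball (G b') ρ' := ball_subset_ball (min_le_right _ _)
    set P := G ⁻¹' ball (G b') τ
    have hPo : IsOpen P := isOpen_ball.preimage hG.continuous
    have hPsub : P ⊆ ball x₀ r := (preimage_mono hτq).trans hΩ
    have hPfin : μ P ≠ ⊤ := measure_ne_top_of_subset hPsub measure_ball_lt_top.ne
    have hPb : P ∩ ball b' r' = G' ⁻¹' ball (G b') τ := by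
      ext x
      constructor
      · rintro ⟨hxP, hxb⟩
        rw [mem_preimage, hG'G hxb]
        exact hxP
      · intro hx
        have hxb : x ∈ ball b' r' := hΩ' (hτρ' hx)
        refine ⟨?_, hxb⟩
        rw [mem_preimage, hG'G hxb] at hx
        exact hx
    have hnear : ∫ x in P ∩ ball b' r', (fderiv ℝ G x).det ∂μ = μ.real (ball (G b') τ) := by
      rw [← hdeg' (G b') τ hτ hτρ', ← hPb]
      refine setIntegral_congr_fun (hPo.measurableSet.inter measurableSet_ball) fun x hx => ?_
      have he : G' =ᶠ[𝓝 x] G := hG'G.eventuallyEq_of_mem (isOpen_ball.mem_nhds hx.2)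
      simp only [he.fderiv_eq]
    have hsplit := integral_inter_add_sdiff (μ := μ) (s := P) (t := ball b' r')
      measurableSet_ball (hG.integrableOn_det_fderiv μ hPfin)
    rw [hnear, hdeg (G b') τ hτ hτq, add_eq_left] at hsplit
    have hfar_fin : μ (P \ ball b' r') ≠ ⊤ := measure_ne_top_of_subset sdiff_subset hPfin
    have hfar : c * μ.real (P \ ball b' r') ≤ ∫ x in P \ ball b' r', (fderiv ℝ G x).det ∂μ :=
      mul_measureReal_le_setIntegral_of_ae (hPo.measurableSet.diff measurableSet_ball) hfar_fin
        (hG.integrableOn_det_fderiv μ hfar_fin)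
        (hGdet.mono fun x hx hxP => hx (hPsub hxP.1))
    have hpos : 0 < μ.real (P \ ball b' r') := by
      refine (hPo.inter hOa).measureReal_pos_of_subset (x := a') ⟨?_, ha'O⟩ (fun x hx => ?_)
        hfar_fin
      · rw [mem_preimage, hab']
        exact mem_ball_self hτ
      · exact ⟨hx.1, fun hxb => disjoint_left.1 hdisj hx.2 (hr'O hxb).1⟩
    have := mul_pos hc hpos
    linarith
  have hGψΩ : EqOn G ψ Ω := hGψ.mono hΩ
  have hrestr : Ω.restrict ψ = Ω.restrict G := by
    ext1 x
    exact (hGψΩ x.2).symm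
  refine ⟨Ω, hΩo, ?_, hΩ.trans hrU, ?_⟩
  · rw [mem_preimage, hGψ (mem_ball_self hr)]
    exact mem_ball_self hρ
  · rw [hrestr]
    refine Topology.IsOpenEmbedding.of_continuous_injective_isOpenMap
      (hG.continuous.comp continuous_subtype_val) hinj.injective fun O hO => ?_
    have : Ω.restrict G '' O = G '' (Subtype.val '' O) := by
      rw [image_image]
      rfl
    rw [this]
    refine hopen _ ?_ (hΩo.isOpenMap_subtype_val O hO)
    rintro _ ⟨x, _, rfl⟩
    exact x.2

end DegreeTheory

/-- Local-homeomorphism part of Reshetnyak's theorem: a locally Lipschitz map on an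
open set `U ⊆ ℝⁿ` whose Jacobian determinant is a.e. bounded below by `c > 0` is a
local homeomorphism off a null set: there is an open `V ⊆ U` of full measure in `U`
such that around each point of `V`, `ψ` restricts to a homeomorphism onto an open set. -/
theorem reshetnyak_local_homeo
    (n : ℕ) (hn : 1 ≤ n)
    (U : Set (EuclideanSpace ℝ (Fin n))) (hU : IsOpen U)
    (ψ : EuclideanSpace ℝ (Fin n) → EuclideanSpace ℝ (Fin n))
    (hlip : ∀ x ∈ U, ∃ K : NNReal, ∃ t ∈ nhds x, t ⊆ U ∧ LipschitzOnWith K ψ t)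
    (c : ℝ) (hc : 0 < c)
    (hjac : ∀ᵐ x ∂(volume.restrict U),
      DifferentiableAt ℝ ψ x ∧ c < (fderiv ℝ ψ x).det) :
    ∃ V : Set (EuclideanSpace ℝ (Fin n)), IsOpen V ∧ V ⊆ U ∧ volume (U \ V) = 0 ∧
      ∀ x ∈ V, ∃ W : Set (EuclideanSpace ℝ (Fin n)), IsOpen W ∧ x ∈ W ∧ W ⊆ U ∧
        Topology.IsOpenEmbedding (W.restrict ψ) := by
  have hjac' : ∀ᵐ x, x ∈ U → DifferentiableAt ℝ ψ x ∧ c < (fderiv ℝ ψ x).det :=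
    (ae_restrict_iff' hU.measurableSet).1 hjac
  refine ⟨{x | ∃ W : Set (EuclideanSpace ℝ (Fin n)), IsOpen W ∧ x ∈ W ∧ W ⊆ U ∧
    Topology.IsOpenEmbedding (W.restrict ψ)}, ?_, ?_, ?_, fun x hx => hx⟩
  · refine isOpen_iff_mem_nhds.2 ?_
    rintro x ⟨W, hW, hxW, hWU, hemb⟩
    exact Filter.mem_of_superset (hW.mem_nhds hxW) fun z hz => ⟨W, hW, hz, hWU, hemb⟩
  · rintro x ⟨W, _, hxW, hWU, _⟩
    exact hWU hxW
  · refine measure_mono_null ?_ (ae_iff.1 hjac')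
    intro x hx hgood
    obtain ⟨hd, hdet⟩ := hgood hx.1
    obtain ⟨K, t, ht, _, hK⟩ := hlip x hx.1
    exact hx.2 (exists_isOpenEmbedding_restrict volume hU hx.1 ht hK hc hjac' hd hdet)
end
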